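/- arXiv:1304.4373 — 3 statements merged into one kernel-verified Lean document; each statement's English description precedes it below -/
import Mathlib

section
/- Let 1 ≤ p < ∞, let 0 < ε < 1/8, and let g ∈ L^p[0,1] be a nonnegative function with ∫₀¹ g = 1 which vanishes outside the interval [1/2 − ε, 1/2 + ε]. Let g̃(x) = g({x + 1/2}) (the left-shift of g by 1/2 on the circle, {·} denoting the fractional part), let A : L^p[0,1] → L^p[0,1] be the cyclic convolution operator (Au)(x) = ∫₀¹ g̃({x − y}) u(y) dy, and set γ₀ = (1/2)·min(λ({x : g(x) ≥ 2}), 1/4), where λ denotes Lebesgue measure. Then for every γ with 0 < γ < γ₀: the infimum over all step functions u of P_γ(u) = γ·J(u) + ‖Au − g‖_p^p equals 2γ, and P_γ(u) > 2γ for every step function u; in particular this infimum is not attained, so the continuous-time inverse Potts functional has no minimizer. -/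
open Filter Topology MeasureTheory
open scoped BigOperators

noncomputable section

/-- `u` is represented as a step function with breakpoints
`0 = t 0 < t 1 < … < t k = 1` and values `c j` on the `j`-th piece. -/
def IsStepRep (u : ℝ → ℝ) {k : ℕ} (t : Fin (k + 1) → ℝ) (c : Fin k → ℝ) : Prop :=
  StrictMono t ∧ t 0 = 0 ∧ t (Fin.last k) = 1 ∧
    ∀ j : Fin k, ∀ x ∈ Set.Ioo (t j.castSucc) (t j.succ), u x = c j

/-- `u` is a step function on `[0,1]`. -/
def IsStepFun (u : ℝ → ℝ) : Prop :=
  ∃ (k : ℕ) (t : Fin (k + 1) → ℝ) (c : Fin k → ℝ), IsStepRep u t c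

/-- The number of jumps of a representation with values `c`. -/
def repJumps {k : ℕ} (c : Fin k → ℝ) : ℕ :=
  Set.ncard {q : Fin k × Fin k | (q.2 : ℕ) = (q.1 : ℕ) + 1 ∧ c q.1 ≠ c q.2}

/-- `J(u)`: the number of jumps of a step function `u` (for the minimal
representation). -/
def numJumps (u : ℝ → ℝ) : ℕ :=
  sInf {j : ℕ | ∃ (k : ℕ) (t : Fin (k + 1) → ℝ) (c : Fin k → ℝ),
    IsStepRep u t c ∧ j = repJumps c}

/-- The left-shift of `g` by `1/2` on the circle. -/
def shiftHalf (g : ℝ → ℝ) : ℝ → ℝ := fun x => g (Int.fract (x + 1 / 2))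

/-- The cyclic convolution operator `(Au)(x) = ∫₀¹ g̃({x − y}) u(y) dy`,
where `g̃` is the left-shift of `g` by `1/2`. -/
def cyclicConv (g : ℝ → ℝ) (u : ℝ → ℝ) : ℝ → ℝ :=
  fun x => ∫ y in (0 : ℝ)..1, shiftHalf g (Int.fract (x - y)) * u y

/-- The continuous-time inverse Potts functional
`P_γ(u) = γ·J(u) + ‖Au − g‖_p^p` (for step functions `u`). -/
def contPotts (γ p : ℝ) (g : ℝ → ℝ) (u : ℝ → ℝ) : ℝ :=
  γ * (numJumps u : ℝ) + ∫ x in (0 : ℝ)..1, |cyclicConv g u x - g x| ^ p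

section Helpers
open Set



/-- The periodised kernel. -/
def kerG (g : ℝ → ℝ) : ℝ → ℝ := fun z => g (Int.fract (z + 1 / 2))

lemma kerG_periodic (g : ℝ → ℝ) : Function.Periodic (kerG g) 1 := by
  intro z
  simp only [kerG]
  rw [show z + 1 + 1 / 2 = (z + 1 / 2) + 1 by ring, Int.fract_add_one]

lemma cyclicConv_eq (g u : ℝ → ℝ) (x : ℝ) :
    cyclicConv g u x = ∫ y in (0 : ℝ)..1, kerG g (x - y) * u y := by
  unfold cyclicConv shiftHalf kerG
  congr 1
  ext y
  congr 2
  have : Int.fract (x - y) + 1 / 2 = (x - y + 1 / 2) - ⌊x - y⌋ := by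
    rw [Int.fract]; ring
  rw [this, Int.fract_sub_intCast]

lemma kerG_measurable {g : ℝ → ℝ} (hmeas : Measurable g) : Measurable (kerG g) := by
  unfold kerG
  exact hmeas.comp (measurable_fract.comp (measurable_id.add_const _))

lemma kerG_half (g : ℝ → ℝ) {x : ℝ} (hx : x ∈ Ico (0 : ℝ) 1) : kerG g (x + 1 / 2) = g x := by
  unfold kerG
  rw [show x + 1 / 2 + 1 / 2 = x + 1 by ring, Int.fract_add_one, Int.fract_eq_self.2 hx]

lemma kerG_zero {ε : ℝ} {g : ℝ → ℝ} 
    (hsupp : ∀ x, x ∉ Set.Icc (1 / 2 - ε) (1 / 2 + ε) → g x = 0) (hε : 0 < ε) {z : ℝ}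
    (h : ε < z ∧ z < 1 - ε ∨ -1 + ε < z ∧ z < - ε) : kerG g z = 0 := by
  have key : ∀ z, ε < z ∧ z < 1 - ε → kerG g z = 0 := by
    intro z hz
    unfold kerG
    apply hsupp
    rintro ⟨h1, h2⟩
    by_cases hh : z + 1 / 2 < 1
    · rw [Int.fract_eq_self.2 ⟨by linarith, hh⟩] at h1 h2
      linarith
    · have : Int.fract (z + 1 / 2) = z - 1 / 2 := by
        rw [show z + 1 / 2 = (z - 1 / 2) + 1 by ring, Int.fract_add_one]
        exact Int.fract_eq_self.2 ⟨by linarith, by linarith⟩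
      rw [this] at h1 h2
      linarith
  rcases h with h | h
  · exact key z h
  · rw [← kerG_periodic g z]
    exact key _ ⟨by linarith, by linarith⟩

lemma g_intervalIntegrable {g : ℝ → ℝ} (hmass : ∫ x in (0 : ℝ)..1, g x = 1) :
    IntervalIntegrable g volume 0 1 := by
  by_contra h
  rw [intervalIntegral.integral_undef h] at hmass
  norm_num at hmass

lemma kerG_intervalIntegrable {g : ℝ → ℝ} (hmass : ∫ x in (0 : ℝ)..1, g x = 1) (a b : ℝ) :
    IntervalIntegrable (kerG g) volume a b := by
  have h1 : IntervalIntegrable (fun x => kerG g (x + 1 / 2)) volume 0 1 := by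
    refine (g_intervalIntegrable hmass).congr_ae ?_
    rw [uIoc_of_le zero_le_one, ← restrict_Ioo_eq_restrict_Ioc]
    filter_upwards [ae_restrict_mem measurableSet_Ioo] with x hx
    exact (kerG_half g ⟨hx.1.le, hx.2⟩).symm
  have hper : Function.Periodic (fun x => kerG g (x + 1 / 2)) 1 := by
    intro z
    have := kerG_periodic g (z + 1 / 2)
    simp only
    rw [← this]; congr 1; ring
  have h2 : IntervalIntegrable (fun x => kerG g (x + 1 / 2)) volume (a - 1 / 2) (b - 1 / 2) :=
    hper.intervalIntegrable₀ one_ne_zero h1 _ _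
  have := h2.comp_sub_right (1 / 2)
  simpa using this

lemma kerG_integral {g : ℝ → ℝ} (hmass : ∫ x in (0 : ℝ)..1, g x = 1) (a : ℝ) :
    ∫ z in a..(a + 1), kerG g z = 1 := by
  rw [(kerG_periodic g).intervalIntegral_add_eq a (0 + 1 / 2)]
  have := intervalIntegral.integral_comp_add_right (a := 0) (b := 1) (kerG g) (1 / 2)
  rw [show (0 : ℝ) + 1 / 2 + 1 = 1 + 1 / 2 by ring, ← this]
  refine Eq.trans ?_ hmass
  rw [intervalIntegral.integral_of_le zero_le_one, intervalIntegral.integral_of_le zero_le_one,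
    ← restrict_Ioo_eq_restrict_Ioc]
  refine setIntegral_congr_fun measurableSet_Ioo ?_
  intro x hx
  exact kerG_half g ⟨hx.1.le, hx.2⟩

lemma kerG_integral_sub {g : ℝ → ℝ} (hmass : ∫ x in (0 : ℝ)..1, g x = 1) (x : ℝ) :
    ∫ y in (0 : ℝ)..1, kerG g (x - y) = 1 := by
  rw [intervalIntegral.integral_comp_sub_left (kerG g) x]
  have := kerG_integral hmass (x - 1)
  simpa using this

lemma kerG_sub_integrable {g : ℝ → ℝ} (hmass : ∫ x in (0 : ℝ)..1, g x = 1) (x : ℝ) :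
    Integrable (fun y => kerG g (x - y)) (volume.restrict (Ioc 0 1)) := by
  have := (kerG_intervalIntegrable hmass (x - 0) (x - 1)).comp_sub_left x
  simp only [sub_sub_cancel] at this
  exact (intervalIntegrable_iff_integrableOn_Ioc_of_le zero_le_one).1 this

/-- Convolution integrand is integrable. -/
lemma conv_integrable {g u : ℝ → ℝ} (hmass : ∫ x in (0 : ℝ)..1, g x = 1) {M : ℝ}
    (hu : AEStronglyMeasurable u (volume.restrict (Ioc (0 : ℝ) 1)))
    (hM : ∀ᵐ y ∂(volume.restrict (Ioc (0 : ℝ) 1)), |u y| ≤ M) (x : ℝ) :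
    Integrable (fun y => kerG g (x - y) * u y) (volume.restrict (Ioc 0 1)) :=
  (kerG_sub_integrable hmass x).mul_bdd hu hM

lemma conv_bound {g u : ℝ → ℝ} (hg0 : ∀ x, 0 ≤ g x)
    (hmass : ∫ x in (0 : ℝ)..1, g x = 1) {M : ℝ}
    (hM : ∀ᵐ y ∂(volume.restrict (Ioc (0 : ℝ) 1)), |u y| ≤ M) (x : ℝ) :
    |cyclicConv g u x| ≤ M := by
  rw [cyclicConv_eq, intervalIntegral.integral_of_le zero_le_one]
  have h1 := kerG_integral_sub hmass x
  rw [intervalIntegral.integral_of_le zero_le_one] at h1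
  have := norm_integral_le_of_norm_le ((kerG_sub_integrable hmass x).mul_const M)
    (f := fun y => kerG g (x - y) * u y) (by
      filter_upwards [hM] with y hy
      rw [norm_mul, Real.norm_of_nonneg (show 0 ≤ kerG g (x - y) from hg0 _)]
      exact mul_le_mul_of_nonneg_left hy (hg0 _))
  rw [integral_mul_const, h1, one_mul] at this
  exact this

lemma conv_le {g u : ℝ → ℝ} (hg0 : ∀ x, 0 ≤ g x)
    (hmass : ∫ x in (0 : ℝ)..1, g x = 1) {M m : ℝ}
    (hu : AEStronglyMeasurable u (volume.restrict (Ioc (0 : ℝ) 1)))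
    (hM : ∀ᵐ y ∂(volume.restrict (Ioc (0 : ℝ) 1)), |u y| ≤ M)
    (hm : ∀ᵐ y ∂(volume.restrict (Ioc (0 : ℝ) 1)), u y ≤ m) (x : ℝ) :
    cyclicConv g u x ≤ m := by
  rw [cyclicConv_eq, intervalIntegral.integral_of_le zero_le_one]
  have h1 := kerG_integral_sub hmass x
  rw [intervalIntegral.integral_of_le zero_le_one] at h1
  have := integral_mono_ae (conv_integrable hmass hu hM x)
    ((kerG_sub_integrable hmass x).mul_const m) (by
      filter_upwards [hm] with y hy
      exact mul_le_mul_of_nonneg_left hy (hg0 _))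
  rw [integral_mul_const, h1, one_mul] at this
  exact this

lemma conv_local {g u : ℝ → ℝ} {ε : ℝ} (hε : 0 < ε)
    (hsupp : ∀ x, x ∉ Set.Icc (1 / 2 - ε) (1 / 2 + ε) → g x = 0)
    (hmass : ∫ x in (0 : ℝ)..1, g x = 1) {a x : ℝ} (hx : x ∈ Icc ε (1 - ε))
    (hu : ∀ᵐ y, y ∈ Icc (x - ε) (x + ε) → u y = a) :
    cyclicConv g u x = a := by
  rw [cyclicConv_eq, intervalIntegral.integral_of_le zero_le_one]
  have h1 := kerG_integral_sub hmass x
  rw [intervalIntegral.integral_of_le zero_le_one] at h1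
  have : ∫ y in Ioc (0 : ℝ) 1, kerG g (x - y) * u y = ∫ y in Ioc (0 : ℝ) 1, kerG g (x - y) * a := by
    rw [← restrict_Ioo_eq_restrict_Ioc]
    refine integral_congr_ae ?_
    filter_upwards [ae_restrict_mem measurableSet_Ioo, ae_restrict_of_ae hu] with y hy hy2
    by_cases hh : y ∈ Icc (x - ε) (x + ε)
    · simp only [hy2 hh]
    · have : kerG g (x - y) = 0 := by
        apply kerG_zero hsupp hε
        obtain ⟨h3, h4⟩ := hx
        obtain ⟨h5, h6⟩ := hy
        by_cases h7 : x - ε ≤ y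
        · right
          have : x + ε < y := by
            by_contra h8
            exact hh ⟨h7, by linarith⟩
          constructor <;> linarith
        · left
          constructor <;> linarith
      simp only [this, zero_mul]
  rw [this, integral_mul_const, h1, one_mul]

lemma conv_aesm {g u : ℝ → ℝ} (hmeas : Measurable g)
    (hu : AEStronglyMeasurable u (volume.restrict (Ioc (0 : ℝ) 1))) :
    StronglyMeasurable (cyclicConv g u) := by
  obtain ⟨v, hv, huv⟩ := hu
  have : cyclicConv g u = fun x => ∫ y, kerG g (x - y) * v y ∂(volume.restrict (Ioc (0 : ℝ) 1)) := by
    ext x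
    rw [cyclicConv_eq, intervalIntegral.integral_of_le zero_le_one]
    refine integral_congr_ae ?_
    filter_upwards [huv] with y hy
    rw [hy]
  rw [this]
  have hm : Measurable (Function.uncurry fun x y => kerG g (x - y) * v y) :=
    ((kerG_measurable hmeas).comp (measurable_fst.sub measurable_snd)).mul
      (hv.measurable.comp measurable_snd)
  exact hm.stronglyMeasurable.integral_prod_right

lemma g_memLp {p : ℝ} (hp : 1 ≤ p) {g : ℝ → ℝ} (hmeas : Measurable g)
    (hLp : IntegrableOn (fun x => |g x| ^ p) (Set.Icc 0 1)) :
    MemLp g (ENNReal.ofReal p) (volume.restrict (Ioc (0 : ℝ) 1)) := by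
  have h0 : ENNReal.ofReal p ≠ 0 := by simp; linarith
  rw [← integrable_norm_rpow_iff hmeas.aestronglyMeasurable h0 ENNReal.ofReal_ne_top,
    ENNReal.toReal_ofReal (by linarith)]
  exact hLp.mono_set Ioc_subset_Icc_self

lemma diff_integrable {p : ℝ} (hp : 1 ≤ p) {g u : ℝ → ℝ} (hmeas : Measurable g)
    (hg0 : ∀ x, 0 ≤ g x)
    (hLp : IntegrableOn (fun x => |g x| ^ p) (Set.Icc 0 1))
    (hmass : ∫ x in (0 : ℝ)..1, g x = 1) {M : ℝ}
    (hu : AEStronglyMeasurable u (volume.restrict (Ioc (0 : ℝ) 1)))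
    (hM : ∀ᵐ y ∂(volume.restrict (Ioc (0 : ℝ) 1)), |u y| ≤ M) :
    Integrable (fun x => |cyclicConv g u x - g x| ^ p) (volume.restrict (Ioc (0 : ℝ) 1)) := by
  have h0 : ENNReal.ofReal p ≠ 0 := by simp; linarith
  have h1 : MemLp (cyclicConv g u) (ENNReal.ofReal p) (volume.restrict (Ioc (0 : ℝ) 1)) :=
    MemLp.of_bound (conv_aesm hmeas hu).aestronglyMeasurable M
      (Eventually.of_forall fun x => conv_bound hg0 hmass hM x)
  have := (h1.sub (g_memLp hp hmeas hLp)).integrable_norm_rpow h0 ENNReal.ofReal_ne_top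
  rw [ENNReal.toReal_ofReal (by linarith)] at this
  exact this

lemma step_cover {k : ℕ} {t : Fin (k + 1) → ℝ} (h0 : t 0 = 0)
    (h1 : t (Fin.last k) = 1) {x : ℝ} (hx : x ∈ Ioo (0 : ℝ) 1) (hxt : x ∉ range t) :
    ∃ j : Fin k, x ∈ Ioo (t j.castSucc) (t j.succ) := by
  by_contra hcon
  push Not at hcon
  have : ∀ j : Fin (k + 1), t j < x := by
    intro j
    induction j using Fin.induction with
    | zero => rw [h0]; exact hx.1
    | succ i ih =>
      have := hcon i
      by_contra h2
      push Not at h2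
      refine this ⟨ih, lt_of_le_of_ne h2 ?_⟩
      intro h3
      exact hxt ⟨_, h3.symm⟩
  have := this (Fin.last k)
  rw [h1] at this
  exact absurd hx.2 (not_lt.2 this.le)

lemma step_ae {u : ℝ → ℝ} {k : ℕ} {t : Fin (k + 1) → ℝ} {c : Fin k → ℝ} (h : IsStepRep u t c) :
    ∀ᵐ x ∂(volume.restrict (Ioc (0 : ℝ) 1)),
      ∃ j : Fin k, x ∈ Ioo (t j.castSucc) (t j.succ) := by
  rw [← restrict_Ioo_eq_restrict_Ioc]
  have hn : ∀ᵐ x, x ∉ range t := (finite_range t).countable.ae_notMem volume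
  filter_upwards [ae_restrict_mem measurableSet_Ioo, ae_restrict_of_ae hn] with x hx hxt
  exact step_cover h.2.1 h.2.2.1 hx hxt

lemma step_bdd {u : ℝ → ℝ} {k : ℕ} {t : Fin (k + 1) → ℝ} {c : Fin k → ℝ} (h : IsStepRep u t c) :
    ∀ᵐ x ∂(volume.restrict (Ioc (0 : ℝ) 1)), |u x| ≤ ∑ j, |c j| := by
  filter_upwards [step_ae h] with x ⟨j, hj⟩
  rw [h.2.2.2 j x hj]
  exact Finset.single_le_sum (f := fun j => |c j|) (fun _ _ => abs_nonneg _) (Finset.mem_univ j)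

lemma step_aesm {u : ℝ → ℝ} {k : ℕ} {t : Fin (k + 1) → ℝ} {c : Fin k → ℝ} (h : IsStepRep u t c) :
    AEStronglyMeasurable u (volume.restrict (Ioc (0 : ℝ) 1)) := by
  have h1 : AEMeasurable u (volume.restrict (⋃ j : Fin k, Ioo (t j.castSucc) (t j.succ))) := by
    rw [aemeasurable_iUnion_iff]
    intro j
    refine ⟨fun _ => c j, measurable_const, ?_⟩
    filter_upwards [ae_restrict_mem measurableSet_Ioo] with x hx
    exact h.2.2.2 j x hx
  refine (h1.mono_measure ?_).aestronglyMeasurable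
  have hs : volume.restrict (Ioc (0 : ℝ) 1) =
      (volume.restrict (Ioc (0 : ℝ) 1)).restrict (⋃ j : Fin k, Ioo (t j.castSucc) (t j.succ)) := by
    symm
    apply Measure.restrict_eq_self_of_ae_mem
    filter_upwards [step_ae h] with x hx
    exact mem_iUnion.2 hx
  rw [hs]
  exact Measure.restrict_mono_measure Measure.restrict_le_self _

/-- At most one jump: the step function has two values. -/
lemma few_jumps {u : ℝ → ℝ} {k : ℕ} {t : Fin (k + 1) → ℝ} {c : Fin k → ℝ} (h : IsStepRep u t c)
    (hJ : repJumps c ≤ 1) :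
    ∃ T a b : ℝ, (∀ᵐ x ∂(volume.restrict (Ioc (0 : ℝ) 1)), x < T → u x = a) ∧
      (∀ᵐ x ∂(volume.restrict (Ioc (0 : ℝ) 1)), T < x → u x = b) := by
  obtain ⟨ht, h0, h1, hv⟩ := id h
  unfold repJumps at hJ
  by_cases hne : ∃ q : Fin k × Fin k, (q.2 : ℕ) = (q.1 : ℕ) + 1 ∧ c q.1 ≠ c q.2
  · obtain ⟨q, hq⟩ := hne
    have huniq : ∀ i j : Fin k, (j : ℕ) = (i : ℕ) + 1 → i ≠ q.1 → c i = c j := by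
      intro i j hij hi
      by_contra hc
      have := (Set.ncard_le_one (Set.toFinite _)).1 hJ (i, j) ⟨hij, hc⟩ q hq
      exact hi (by rw [← this])
    have hlow : ∀ n : ℕ, ∀ i : Fin k, (i : ℕ) + n = q.1 → c i = c q.1 := by
      intro n
      induction n with
      | zero => intro i hi; congr 1; exact Fin.ext (by simpa using hi)
      | succ n ih =>
        intro i hi
        have hlt := q.1.isLt
        have := huniq i ⟨i + 1, by omega⟩ rfl (by intro hh; rw [hh] at hi; omega)
        rw [this]
        exact ih _ (by simp; omega)
    have hhigh : ∀ n : ℕ, ∀ i : Fin k, (i : ℕ) = q.2 + n → c i = c q.2 := by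
      intro n
      induction n with
      | zero => intro i hi; congr 1; exact Fin.ext (by simpa using hi)
      | succ n ih =>
        intro i hi
        have hlt := i.isLt
        have := huniq ⟨i - 1, by omega⟩ i (by simp; omega)
          (by intro hh; have := congrArg Fin.val hh; simp at this; omega)
        rw [← this]
        exact ih _ (by simp; omega)
    refine ⟨t q.2.castSucc, c q.1, c q.2, ?_, ?_⟩
    · filter_upwards [step_ae h] with x ⟨j, hj⟩ hx
      rw [hv j x hj]
      have h3 : t j.castSucc < t q.2.castSucc := hj.1.trans hx
      have h4 := ht.lt_iff_lt.1 h3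
      have h5 : (j : ℕ) < q.2 := h4
      exact hlow (q.1 - j) j (by omega)
    · filter_upwards [step_ae h] with x ⟨j, hj⟩ hx
      rw [hv j x hj]
      have h3 : t q.2.castSucc < t j.succ := hx.trans hj.2
      have h4 := ht.lt_iff_lt.1 h3
      have h5 : (q.2 : ℕ) < j + 1 := by simpa [Fin.lt_def] using h4
      exact hhigh (j - q.2) j (by omega)
  · push Not at hne
    have hk : 0 < k := by
      rcases Nat.eq_zero_or_pos k with hk | hk
      · subst hk
        have : t 0 = t (Fin.last 0) := rfl
        rw [h0, h1] at this
        norm_num at this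
      · exact hk
    have hc : ∀ n : ℕ, ∀ hn : n < k, c ⟨n, hn⟩ = c ⟨0, hk⟩ := by
      intro n
      induction n with
      | zero => intro _; rfl
      | succ n ih =>
        intro hn
        rw [← ih (by omega)]
        exact (hne (⟨n, by omega⟩, ⟨n + 1, hn⟩) rfl).symm
    refine ⟨0, c ⟨0, hk⟩, c ⟨0, hk⟩, ?_, ?_⟩ <;>
    · filter_upwards [step_ae h] with x ⟨j, hj⟩ _
      rw [hv j x hj]
      exact hc j j.isLt

/-- The measure estimate for two-valued functions. -/
lemma bad_set {ε : ℝ} (hε : 0 < ε) (hε' : ε < 1 / 8) {g u : ℝ → ℝ}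
    (hmeas : Measurable g) (hg0 : ∀ x, 0 ≤ g x)
    (hmass : ∫ x in (0 : ℝ)..1, g x = 1)
    (hsupp : ∀ x, x ∉ Set.Icc (1 / 2 - ε) (1 / 2 + ε) → g x = 0) {M T a b : ℝ}
    (hu : AEStronglyMeasurable u (volume.restrict (Ioc (0 : ℝ) 1)))
    (hM : ∀ᵐ y ∂(volume.restrict (Ioc (0 : ℝ) 1)), |u y| ≤ M)
    (ha : ∀ᵐ x ∂(volume.restrict (Ioc (0 : ℝ) 1)), x < T → u x = a)
    (hb : ∀ᵐ x ∂(volume.restrict (Ioc (0 : ℝ) 1)), T < x → u x = b) :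
    min ((volume {x ∈ Set.Icc (0 : ℝ) 1 | 2 ≤ g x}).toReal) (1 / 4) ≤
      volume.real {x ∈ Ioc (0 : ℝ) 1 | 1 ≤ |cyclicConv g u x - g x|} := by
  set B := {x ∈ Ioc (0 : ℝ) 1 | 1 ≤ |cyclicConv g u x - g x|} with hB
  set K := {x ∈ Set.Icc (0 : ℝ) 1 | 2 ≤ g x} with hK
  change min (volume.real K) _ ≤ _
  have hBfin : volume B ≠ ⊤ := measure_ne_top_of_subset (fun x hx => hx.1) (by simp)
  have hKfin : volume K ≠ ⊤ := measure_ne_top_of_subset (fun x hx => hx.1) (by simp)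
  have hKm : MeasurableSet K := measurableSet_Icc.inter (measurableSet_le measurable_const hmeas)
  have hKs : K ⊆ Icc (1 / 2 - ε) (1 / 2 + ε) := by
    intro x hx
    by_contra h
    have := hsupp x h
    have h2 := hx.2
    linarith
  have h01 : ∀ᵐ x, x ≠ T := by
    have := (Set.countable_singleton T).ae_notMem volume
    simpa using this
  rw [ae_restrict_iff' measurableSet_Ioc] at ha hb
  -- values of the convolution
  have hva : ∀ x, ε < x → x < 1 - ε → x < T - ε → cyclicConv g u x = a := by
    intro x h1 h2 h3
    refine conv_local hε hsupp hmass ⟨h1.le, h2.le⟩ ?_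
    filter_upwards [ha] with y hy hy2
    exact hy ⟨by linarith [hy2.1], by linarith [hy2.2]⟩ (by linarith [hy2.2])
  have hvb : ∀ x, ε < x → x < 1 - ε → T + ε < x → cyclicConv g u x = b := by
    intro x h1 h2 h3
    refine conv_local hε hsupp hmass ⟨h1.le, h2.le⟩ ?_
    filter_upwards [hb] with y hy hy2
    exact hy ⟨by linarith [hy2.1], by linarith [hy2.2]⟩ (by linarith [hy2.1])
  -- pointwise membership
  have hBhigh : ∀ x, 0 < x → x < 1 → x ∉ Set.Icc (1 / 2 - ε) (1 / 2 + ε) →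
      1 ≤ cyclicConv g u x → x ∈ B := by
    intro x h0 h1 h2 h3
    refine ⟨⟨h0, h1.le⟩, ?_⟩
    rw [hsupp x h2, sub_zero]
    exact h3.trans (le_abs_self _)
  have hBlow : ∀ x ∈ K, cyclicConv g u x ≤ 1 → x ∈ B := by
    intro x hx h3
    have h4 := hKs hx
    refine ⟨⟨by linarith [h4.1], by linarith [h4.2]⟩, ?_⟩
    rw [abs_sub_comm]
    refine le_trans ?_ (le_abs_self _)
    linarith [hx.2]
  have mono : ∀ S, S ⊆ B → volume.real S ≤ volume.real B := fun S hS =>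
    measureReal_mono hS hBfin
  by_cases ha1 : a ≤ 1
  · by_cases hb1 : b ≤ 1
    · -- both small
      refine (min_le_left _ _).trans (mono _ ?_)
      intro x hx
      refine hBlow x hx (conv_le hg0 hmass hu hM ?_ x)
      rw [ae_restrict_iff' measurableSet_Ioc]
      filter_upwards [ha, hb, h01] with y h1 h2 h3 hy
      rcases lt_or_gt_of_ne h3 with h | h
      · rw [h1 hy h]; exact ha1
      · rw [h2 hy h]; exact hb1
    · push Not at hb1
      by_cases hT : T ≤ 1 / 2
      · refine (min_le_right _ _).trans (le_trans ?_ (mono (Ioo (1 / 2 + ε) (1 - ε)) ?_))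
        · rw [Real.volume_real_Ioo_of_le (by linarith)]; linarith
        · intro x hx
          obtain ⟨h1, h2⟩ := hx
          refine hBhigh x (by linarith) (by linarith) (fun h => by linarith [h.2]) ?_
          rw [hvb x (by linarith) h2 (by linarith)]; exact hb1.le
      · push Not at hT
        refine (min_le_left _ _).trans ?_
        have hsub : (K \ Ico (T - ε) (1 / 2 + ε + (1 / 2 - 4 * ε))) ∪ Ioo (T + ε) (1 - ε) ⊆ B := by
          rintro x (hx | hx)
          · have h4 := hKs hx.1
            refine hBlow x hx.1 ?_
            rw [hva x (by linarith [h4.1]) (by linarith [h4.2]) ?_]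
            · exact ha1
            · by_contra h5
              exact hx.2 ⟨by linarith, by linarith [h4.2]⟩
          · obtain ⟨h1, h2⟩ := hx
            refine hBhigh x (by linarith) (by linarith) (fun h => by linarith [h.2]) ?_
            rw [hvb x (by linarith) h2 (by linarith)]; exact hb1.le
        refine le_trans ?_ (mono _ hsub)
        rw [measureReal_union ?_ measurableSet_Ioo (measure_ne_top_of_subset (sdiff_subset) hKfin)
          (by simp)]
        · have h5 := le_measureReal_sdiff (μ := volume) (s₁ := K)
            (s₂ := Ico (T - ε) (1 / 2 + ε + (1 / 2 - 4 * ε))) (by simp)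
          rw [Real.volume_real_Ico] at h5
          rw [Real.volume_real_Ioo]
          have : max (1 / 2 + ε + (1 / 2 - 4 * ε) - (T - ε)) 0 = max (1 - ε - (T + ε)) 0 := by
            congr 1; ring
          linarith
        · rw [Set.disjoint_left]
          intro x hx hx2
          have h4 := hKs hx.1
          linarith [hx2.1, h4.2]
  · push Not at ha1
    by_cases hT : 1 / 2 ≤ T
    · refine (min_le_right _ _).trans (le_trans ?_ (mono (Ioo ε (1 / 2 - ε)) ?_))
      · rw [Real.volume_real_Ioo_of_le (by linarith)]; linarith
      · intro x hx
        obtain ⟨h1, h2⟩ := hx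
        refine hBhigh x (by linarith) (by linarith) (fun h => by linarith [h.1]) ?_
        rw [hva x (by linarith) (by linarith) (by linarith)]; exact ha1.le
    · push Not at hT
      by_cases hb1 : b ≤ 1
      · refine (min_le_left _ _).trans ?_
        have hsub : (K \ Ioc (3 * ε) (T + ε)) ∪ Ioo ε (T - ε) ⊆ B := by
          rintro x (hx | hx)
          · have h4 := hKs hx.1
            refine hBlow x hx.1 ?_
            rw [hvb x (by linarith [h4.1]) (by linarith [h4.2]) ?_]
            · exact hb1
            · by_contra h5
              exact hx.2 ⟨by linarith [h4.1], by linarith⟩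
          · obtain ⟨h1, h2⟩ := hx
            refine hBhigh x (by linarith) (by linarith) (fun h => by linarith [h.1]) ?_
            rw [hva x (by linarith) (by linarith) (by linarith)]; exact ha1.le
        refine le_trans ?_ (mono _ hsub)
        rw [measureReal_union ?_ measurableSet_Ioo (measure_ne_top_of_subset (sdiff_subset) hKfin)
          (by simp)]
        · have h5 := le_measureReal_sdiff (μ := volume) (s₁ := K)
            (s₂ := Ioc (3 * ε) (T + ε)) (by simp)
          rw [Real.volume_real_Ioc] at h5
          rw [Real.volume_real_Ioo]
          have : max (T + ε - 3 * ε) 0 = max (T - ε - ε) 0 := by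
            congr 1; ring
          linarith
        · rw [Set.disjoint_left]
          intro x hx hx2
          have h4 := hKs hx.1
          linarith [hx2.2, h4.1]
      · push Not at hb1
        refine (min_le_right _ _).trans (le_trans ?_ (mono (Ioo (1 / 2 + ε) (1 - ε)) ?_))
        · rw [Real.volume_real_Ioo_of_le (by linarith)]; linarith
        · intro x hx
          obtain ⟨h1, h2⟩ := hx
          refine hBhigh x (by linarith) (by linarith) (fun h => by linarith [h.2]) ?_
          rw [hvb x (by linarith) h2 (by linarith)]; exact hb1.le

/-- The character `exp (-2πi k x)`. -/
def chr (k : ℤ) (x : ℝ) : ℂ := Complex.exp (-(2 * Real.pi * Complex.I * k * x))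

lemma chr_continuous (k : ℤ) : Continuous (chr k) := by
  unfold chr; fun_prop

lemma chr_norm (k : ℤ) (x : ℝ) : ‖chr k x‖ = 1 := by
  unfold chr
  rw [show -(2 * Real.pi * Complex.I * k * x) = ((-(2 * Real.pi * k * x) : ℝ) : ℂ) * Complex.I by
    push_cast; ring]
  exact Complex.norm_exp_ofReal_mul_I _

lemma chr_add (k : ℤ) (x y : ℝ) : chr k (x + y) = chr k x * chr k y := by
  unfold chr
  rw [← Complex.exp_add]; congr 1; push_cast; ring

lemma chr_periodic (k : ℤ) : Function.Periodic (chr k) 1 := by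
  intro x
  rw [chr_add]
  have : chr k 1 = 1 := by
    unfold chr
    rw [Complex.exp_eq_one_iff]
    exact ⟨-k, by push_cast; ring⟩
  rw [this, mul_one]

/-- Fourier coefficient on the unit interval. -/
def FC (f : ℝ → ℂ) (k : ℤ) : ℂ := ∫ x in (0 : ℝ)..1, chr k x * f x

lemma FC_eq (f : ℝ → ℂ) (k : ℤ) : fourierCoeffOn (zero_lt_one : (0 : ℝ) < 1) f k = FC f k := by
  rw [fourierCoeffOn_eq_integral, FC]
  rw [sub_zero, div_one, one_smul]
  congr 1
  ext x
  rw [smul_eq_mul]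
  congr 1
  rw [fourier_coe_apply, chr]
  congr 1
  push_cast
  ring

lemma FC_shift {g : ℝ → ℝ} (k : ℤ) (y : ℝ) :
    ∫ x in (0 : ℝ)..1, chr k x * (kerG g (x + y) : ℂ) = 
      chr k (-y) * FC (fun x => (kerG g x : ℂ)) k := by
  have h1 : ∀ x, chr k x * (kerG g (x + y) : ℂ) =
      chr k (-y) * (fun z => chr k z * (kerG g z : ℂ)) (x + y) := by
    intro x
    simp only
    rw [← mul_assoc, ← chr_add]
    congr 2
    ring
  simp_rw [h1]
  rw [intervalIntegral.integral_const_mul,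
    intervalIntegral.integral_comp_add_right (fun z => chr k z * (kerG g z : ℂ)) y, FC]
  congr 1
  have hper : Function.Periodic (fun z => chr k z * (kerG g z : ℂ)) 1 := by
    intro z
    simp only
    rw [chr_periodic k z, kerG_periodic g z]
  have := hper.intervalIntegral_add_eq (0 + y) 0
  rw [show (0 : ℝ) + y + 1 = 1 + y by ring, zero_add 1] at this
  exact this

lemma FC_g (g : ℝ → ℝ) (k : ℤ) :
    FC (fun x => (g x : ℂ)) k = chr k (-(1 / 2)) * FC (fun x => (kerG g x : ℂ)) k := by
  rw [← FC_shift, FC]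
  rw [intervalIntegral.integral_of_le zero_le_one, intervalIntegral.integral_of_le zero_le_one,
    ← restrict_Ioo_eq_restrict_Ioc]
  refine setIntegral_congr_fun measurableSet_Ioo ?_
  intro x hx
  simp only
  rw [kerG_half g ⟨hx.1.le, hx.2⟩]

lemma kerG_add_integrable {g : ℝ → ℝ} (hmass : ∫ x in (0 : ℝ)..1, g x = 1) (y : ℝ) :
    Integrable (fun x => kerG g (x - y)) (volume.restrict (Ioc 0 1)) := by
  have := (kerG_intervalIntegrable hmass (0 - y) (1 - y)).comp_sub_right y
  simp only [sub_add_cancel] at this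
  exact (intervalIntegrable_iff_integrableOn_Ioc_of_le zero_le_one).1 this

lemma FC_conv {g u : ℝ → ℝ} (hmeas : Measurable g) (hg0 : ∀ x, 0 ≤ g x)
    (hmass : ∫ x in (0 : ℝ)..1, g x = 1) {M : ℝ}
    (hu : AEStronglyMeasurable u (volume.restrict (Ioc (0 : ℝ) 1)))
    (hM : ∀ᵐ y ∂(volume.restrict (Ioc (0 : ℝ) 1)), |u y| ≤ M) (k : ℤ) :
    FC (fun x => (cyclicConv g u x : ℂ)) k =
      FC (fun x => (u x : ℂ)) k * FC (fun x => (kerG g x : ℂ)) k := by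
  set μ := volume.restrict (Ioc (0 : ℝ) 1) with hμ
  have huI : Integrable u μ := Integrable.of_bound hu M hM
  have hint : Integrable (Function.uncurry fun x y => chr k x * ((kerG g (x - y) : ℂ) * (u y : ℂ)))
      (μ.prod μ) := by
    have hms : AEStronglyMeasurable
        (Function.uncurry fun x y => chr k x * ((kerG g (x - y) : ℂ) * (u y : ℂ))) (μ.prod μ) := by
      have a1 : AEStronglyMeasurable (fun q : ℝ × ℝ => chr k q.1) (μ.prod μ) :=
        ((chr_continuous k).comp continuous_fst).aestronglyMeasurable
      have a2 : AEStronglyMeasurable (fun q : ℝ × ℝ => (kerG g (q.1 - q.2) : ℂ)) (μ.prod μ) :=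
        (Complex.measurable_ofReal.comp
          ((kerG_measurable hmeas).comp (measurable_fst.sub measurable_snd))).aestronglyMeasurable
      have a3 : AEStronglyMeasurable (fun q : ℝ × ℝ => (u q.2 : ℂ)) (μ.prod μ) :=
        Complex.continuous_ofReal.comp_aestronglyMeasurable hu.comp_snd
      exact a1.mul (a2.mul a3)
    rw [integrable_prod_iff' hms]
    have hn : ∀ x y, ‖Function.uncurry (fun x y => chr k x * ((kerG g (x - y) : ℂ) * (u y : ℂ))) (x, y)‖
        = kerG g (x - y) * |u y| := by
      intro x y
      simp only [Function.uncurry_apply_pair, norm_mul, chr_norm, one_mul, Complex.norm_real]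
      rw [Real.norm_of_nonneg (show 0 ≤ kerG g (x - y) from hg0 _), Real.norm_eq_abs]
    constructor
    · refine Eventually.of_forall fun y => ?_
      have b1 : Integrable (fun x => ((kerG g (x - y) : ℂ) * (u y : ℂ))) μ :=
        ((kerG_add_integrable hmass y).ofReal).mul_const _
      exact b1.bdd_mul (c := 1) (chr_continuous k).aestronglyMeasurable
        (Eventually.of_forall fun x => (chr_norm k x).le)
    · simp_rw [hn, integral_mul_const]
      have : ∀ y, ∫ x, kerG g (x - y) ∂μ = 1 := by
        intro y
        rw [hμ, ← intervalIntegral.integral_of_le zero_le_one,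
          intervalIntegral.integral_comp_sub_right (kerG g) y]
        have := kerG_integral hmass (0 - y)
        rwa [show (0 : ℝ) - y + 1 = 1 - y by ring] at this
      simp_rw [this, one_mul]
      exact huI.abs
  have hL : FC (fun x => (cyclicConv g u x : ℂ)) k =
      ∫ x, ∫ y, chr k x * ((kerG g (x - y) : ℂ) * (u y : ℂ)) ∂μ ∂μ := by
    rw [FC, intervalIntegral.integral_of_le zero_le_one]
    congr 1
    ext x
    rw [integral_const_mul, cyclicConv_eq, intervalIntegral.integral_of_le zero_le_one]
    congr 1
    refine (integral_ofReal (𝕜 := ℂ)).symm.trans ?_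
    congr 1
    ext y
    push_cast
    rfl
  rw [hL, integral_integral_swap hint]
  conv_rhs => rw [FC, intervalIntegral.integral_of_le zero_le_one, ← integral_mul_const]
  congr 1
  ext y
  have h1 := FC_shift (g := g) k (-y)
  rw [intervalIntegral.integral_of_le zero_le_one, neg_neg] at h1
  simp_rw [← sub_eq_add_neg] at h1
  rw [mul_assoc, mul_comm (u y : ℂ), ← mul_assoc, ← h1, ← integral_mul_const]
  congr 1
  ext x
  ring

lemma FC_char (k n : ℤ) : FC (fun x => chr (-n) x) k = if k = n then 1 else 0 := by
  unfold FC
  split_ifs with h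
  · subst h
    have : ∀ x, chr k x * chr (-k) x = 1 := by
      intro x
      unfold chr
      rw [← Complex.exp_add]
      rw [Complex.exp_eq_one_iff]
      exact ⟨0, by push_cast; ring⟩
    simp [this]
  · have hkn : ((n : ℂ) - k) ≠ 0 := by
      intro hh
      have : (n : ℂ) = k := sub_eq_zero.1 hh
      exact h (by exact_mod_cast this.symm)
    have hne : (2 * Real.pi * Complex.I * (n - k)) ≠ 0 :=
      mul_ne_zero Complex.two_pi_I_ne_zero hkn
    have : ∀ x : ℝ, chr k x * chr (-n) x = Complex.exp ((2 * Real.pi * Complex.I * (n - k)) * x) := by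
      intro x
      unfold chr
      rw [← Complex.exp_add]
      congr 1
      push_cast
      ring
    simp_rw [this]
    rw [integral_exp_mul_complex hne]
    have h1 : Complex.exp (2 * Real.pi * Complex.I * (n - k) * (1 : ℝ)) = 1 := by
      rw [Complex.exp_eq_one_iff]
      exact ⟨n - k, by push_cast; ring⟩
    rw [h1]
    simp

lemma conv_ne {ε : ℝ} (hε' : ε < 1 / 8) {g u : ℝ → ℝ}
    (hmeas : Measurable g) (hg0 : ∀ x, 0 ≤ g x)
    (hmass : ∫ x in (0 : ℝ)..1, g x = 1)
    (hsupp : ∀ x, x ∉ Set.Icc (1 / 2 - ε) (1 / 2 + ε) → g x = 0) {M : ℝ}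
    (hu : AEStronglyMeasurable u (volume.restrict (Ioc (0 : ℝ) 1)))
    (hM : ∀ᵐ y ∂(volume.restrict (Ioc (0 : ℝ) 1)), |u y| ≤ M)
    (heq : ∀ᵐ x ∂(volume.restrict (Ioc (0 : ℝ) 1)), cyclicConv g u x = g x) : False := by
  set μ := volume.restrict (Ioc (0 : ℝ) 1) with hμ
  have hgM : ∀ᵐ x ∂μ, ‖(g x : ℂ)‖ ≤ M := by
    filter_upwards [heq] with x hx
    rw [← hx, Complex.norm_real]
    exact conv_bound hg0 hmass hM x
  have hgL : MemLp (fun x => (g x : ℂ)) 2 μ :=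
    MemLp.of_bound (Complex.measurable_ofReal.comp hmeas).aestronglyMeasurable M hgM
  have huL : MemLp (fun x => (u x : ℂ)) 2 μ :=
    MemLp.of_bound (Complex.continuous_ofReal.comp_aestronglyMeasurable hu) M
      (by filter_upwards [hM] with x hx; rw [Complex.norm_real]; exact hx)
  have hsum := (hasSum_sq_fourierCoeffOn (zero_lt_one : (0 : ℝ) < 1) huL).summable
  simp_rw [FC_eq] at hsum
  have hev := hsum.tendsto_cofinite_zero.eventually (gt_mem_nhds zero_lt_one)
  have hfin : {k : ℤ | FC (fun x => (g x : ℂ)) k ≠ 0}.Finite := by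
    refine Set.Finite.subset hev ?_
    intro k hk hk2
    apply hk
    have h1 : FC (fun x => (g x : ℂ)) k =
        FC (fun x => (u x : ℂ)) k * FC (fun x => (kerG g x : ℂ)) k := by
      rw [← FC_conv hmeas hg0 hmass hu hM, FC, FC, intervalIntegral.integral_of_le zero_le_one,
        intervalIntegral.integral_of_le zero_le_one]
      refine integral_congr_ae ?_
      filter_upwards [heq] with x hx
      rw [hx]
    have h2 := FC_g g k
    by_cases h0 : FC (fun x => (kerG g x : ℂ)) k = 0
    · rw [h1, h0, mul_zero]
    · exfalso
      rw [h2] at h1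
      have h3 := mul_right_cancel₀ h0 h1
      have h4 : ‖FC (fun x => (u x : ℂ)) k‖ = 1 := by rw [← h3, chr_norm]
      have hk3 : ‖FC (fun x => (u x : ℂ)) k‖ ^ 2 < 1 := hk2
      rw [h4] at hk3
      norm_num at hk3
  set S := hfin.toFinset with hS
  set P : ℝ → ℂ := fun x => ∑ n ∈ S, FC (fun x => (g x : ℂ)) n * chr (-n) x with hP
  have hPc : Continuous P := by
    refine continuous_finsetSum _ fun n _ => ?_
    exact continuous_const.mul (chr_continuous _)
  have hPL : MemLp P 2 μ := by
    refine memLp_finsetSum _ fun n _ => ?_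
    refine MemLp.of_bound (continuous_const.mul (chr_continuous _)).aestronglyMeasurable
      ‖FC (fun x => (g x : ℂ)) n‖ (Eventually.of_forall fun x => ?_)
    rw [norm_mul, chr_norm, mul_one]
  have hd : MemLp (fun x => (g x : ℂ) - P x) 2 μ := hgL.sub hPL
  have hgi : IntervalIntegrable (fun x => (g x : ℂ)) volume 0 1 :=
    (intervalIntegrable_iff_integrableOn_Ioc_of_le zero_le_one).2
      (hgL.integrable (by norm_num))
  have hcoef : ∀ k, FC (fun x => (g x : ℂ) - P x) k = 0 := by
    intro k
    have e1 : FC (fun x => (g x : ℂ) - P x) k = FC (fun x => (g x : ℂ)) k - FC P k := by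
      unfold FC
      rw [← intervalIntegral.integral_sub]
      · simp_rw [mul_sub]
      · exact hgi.continuousOn_mul (chr_continuous k).continuousOn
      · exact ((chr_continuous k).mul hPc).intervalIntegrable _ _
    have e2 : FC P k = ∑ n ∈ S, FC (fun x => (g x : ℂ)) n * FC (fun x => chr (-n) x) k := by
      conv_lhs => unfold FC
      simp only [hP, Finset.mul_sum]
      rw [intervalIntegral.integral_finsetSum]
      · refine Finset.sum_congr rfl fun n _ => ?_
        conv_rhs => rw [FC.eq_1 (fun x => chr (-n) x), ← intervalIntegral.integral_const_mul]
        congr 1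
        ext x
        ring
      · intro n _
        exact ((chr_continuous k).mul (continuous_const.mul (chr_continuous _))).intervalIntegrable _ _
    rw [e1, e2]
    simp_rw [FC_char]
    simp only [mul_ite, mul_one, mul_zero, Finset.sum_ite_eq]
    split_ifs with h
    · exact sub_self _
    · simp [hS] at h
      rw [h, sub_zero]
  have hpars := hasSum_sq_fourierCoeffOn (zero_lt_one : (0 : ℝ) < 1) hd
  simp_rw [FC_eq, hcoef] at hpars
  have hz : ∫ x in (0 : ℝ)..1, ‖(g x : ℂ) - P x‖ ^ 2 = 0 := by
    have := hpars.unique (a₂ := 0) (by simpa using (hasSum_zero : HasSum (fun _ : ℤ => (0 : ℝ)) 0))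
    simpa using this
  rw [intervalIntegral.integral_of_le zero_le_one, integral_eq_zero_iff_of_nonneg
    (fun x => by positivity) hd.norm.integrable_sq] at hz
  have hgP : ∀ᵐ x ∂μ, (g x : ℂ) = P x := by
    filter_upwards [hz] with x hx
    simp only [Pi.zero_apply] at hx
    exact sub_eq_zero.1 (norm_eq_zero.1 (pow_eq_zero_iff (by norm_num) |>.1 hx))
  -- P vanishes near 1/8
  have hPz : EqOn P 0 (Ioo 0 (3 / 8)) := by
    refine Measure.eqOn_open_of_ae_eq (μ := volume) ?_ isOpen_Ioo hPc.continuousOn continuousOn_const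
    have hsub : Ioo (0 : ℝ) (3 / 8) ⊆ Ioc 0 1 := fun x hx => ⟨hx.1, by linarith [hx.2]⟩
    filter_upwards [ae_restrict_mem measurableSet_Ioo, ae_restrict_of_ae_restrict_of_subset hsub hgP]
      with x hx hx2
    rw [← hx2, hsupp x (fun h => by linarith [h.1, hx.2])]
    simp
  have hPan : AnalyticOnNhd ℝ P univ := by
    intro x _
    refine Finset.analyticAt_fun_sum _ fun n _ => ?_
    unfold chr
    refine analyticAt_const.mul ?_
    refine (analyticAt_cexp.restrictScalars (𝕜 := ℝ)).fun_comp ?_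
    refine AnalyticAt.neg ?_
    exact analyticAt_const.mul (Complex.ofRealCLM.analyticAt x)
  have hP0 := hPan.eqOn_zero_of_preconnected_of_eventuallyEq_zero isPreconnected_univ
    (mem_univ (1 / 8 : ℝ)) (by
      filter_upwards [isOpen_Ioo.mem_nhds (show (1 / 8 : ℝ) ∈ Ioo (0 : ℝ) (3 / 8) by
        constructor <;> norm_num)] with x hx
      exact hPz hx)
  have : ∫ x in (0 : ℝ)..1, g x = 0 := by
    rw [intervalIntegral.integral_of_le zero_le_one]
    refine integral_eq_zero_of_ae ?_
    filter_upwards [hgP] with x hx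
    rw [hP0 (mem_univ x)] at hx
    simpa using hx
  rw [this] at hmass
  norm_num at hmass

lemma g_memLp_full {p ε : ℝ} (hp : 1 ≤ p) (hε' : ε < 1 / 8) {g : ℝ → ℝ} (hmeas : Measurable g)
    (hLp : IntegrableOn (fun x => |g x| ^ p) (Set.Icc 0 1))
    (hsupp : ∀ x, x ∉ Set.Icc (1 / 2 - ε) (1 / 2 + ε) → g x = 0) :
    MemLp g (ENNReal.ofReal p) volume := by
  have h0 : ENNReal.ofReal p ≠ 0 := by simp; linarith
  rw [← integrable_norm_rpow_iff hmeas.aestronglyMeasurable h0 ENNReal.ofReal_ne_top,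
    ENNReal.toReal_ofReal (by linarith)]
  refine (integrableOn_iff_integrable_of_support_subset ?_).1 hLp
  intro x hx
  by_contra h
  apply hx
  have : g x = 0 := hsupp x (fun h2 => h ⟨by linarith [h2.1], by linarith [h2.2]⟩)
  simp only [this, norm_zero]
  exact Real.zero_rpow (by linarith)

lemma translation_cont {p : ℝ} (hp : 1 ≤ p) {g : ℝ → ℝ}
    (hg : MemLp g (ENNReal.ofReal p) volume) {δ : ℝ} (hδ : 0 < δ) :
    ∃ η > 0, ∀ s : ℝ, |s| < η → ∫ x, |g (s + x) - g x| ^ p ≤ δ := by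
  have : Fact (1 ≤ ENNReal.ofReal p) := ⟨by simpa using ENNReal.ofReal_le_ofReal hp⟩
  have : Fact (ENNReal.ofReal p ≠ ⊤) := ⟨ENNReal.ofReal_ne_top⟩
  have h0 : ENNReal.ofReal p ≠ 0 := by simp; linarith
  have hc : Continuous fun s : ℝ => (DomAddAct.mk s +ᵥ hg.toLp g : Lp ℝ (ENNReal.ofReal p) volume) :=
    (DomAddAct.continuous_mk).vadd continuous_const
  have hc0 := Metric.continuous_iff.1 hc 0 (δ ^ (1 / p)) (by positivity)
  obtain ⟨η, hη, h⟩ := hc0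
  refine ⟨η, hη, fun s hs => ?_⟩
  have h1 := h s (by simpa using hs)
  rw [DomAddAct.mk_vadd_toLp, DomAddAct.mk_vadd_toLp, dist_eq_norm, ← MemLp.toLp_sub,
    Lp.norm_toLp] at h1
  have hm : MemLp (fun x => g (s + x) - g x) (ENNReal.ofReal p) volume :=
    (hg.comp_measurePreserving (measurePreserving_add_left volume s)).sub hg
  have h2 : eLpNorm (fun x => g (s + x) - g x) (ENNReal.ofReal p) volume =
      ENNReal.ofReal ((∫ x, |g (s + x) - g x| ^ p) ^ (1 / p)) := by
    rw [hm.eLpNorm_eq_integral_rpow_norm h0 ENNReal.ofReal_ne_top,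
      ENNReal.toReal_ofReal (by linarith), one_div]
    rfl
  have h3 : ((fun x => g (s +ᵥ x)) - fun x => g ((0 : ℝ) +ᵥ x)) = fun x => g (s + x) - g x := by
    ext x
    simp
  rw [h3, h2, ENNReal.toReal_ofReal (Real.rpow_nonneg (integral_nonneg fun x => by positivity) _)] at h1
  exact ((Real.rpow_lt_rpow_iff (integral_nonneg fun x => by positivity) hδ.le (by positivity)).1 h1).le

/-- The approximating peak. -/
def peak (η : ℝ) : ℝ → ℝ := (Ioc (1 / 2 - η) (1 / 2 + η)).indicator fun _ => 1 / (2 * η)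

lemma peak_rep {η : ℝ} (hη : 0 < η) (hη' : η < 1 / 8) :
    IsStepRep (peak η) ![0, 1 / 2 - η, 1 / 2 + η, 1] ![0, 1 / (2 * η), 0] := by
  refine ⟨?_, rfl, rfl, ?_⟩
  · rw [Fin.strictMono_iff_lt_succ]
    intro i
    fin_cases i <;> simp <;> linarith
  · intro j x hx
    unfold peak
    fin_cases j
    · simp at hx
      refine indicator_of_notMem (fun h => ?_) _
      simp at h
      linarith
    · simp at hx
      refine indicator_of_mem ?_ _
      simp
      constructor <;> linarith
    · simp at hx
      refine indicator_of_notMem (fun h => ?_) _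
      simp at h
      linarith

lemma peak_jumps {η : ℝ} (hη : 0 < η) (hη' : η < 1 / 8) : numJumps (peak η) ≤ 2 := by
  have hle : numJumps (peak η) ≤ repJumps (![0, 1 / (2 * η), 0] : Fin 3 → ℝ) :=
    Nat.sInf_le ⟨3, _, _, peak_rep hη hη', rfl⟩
  refine hle.trans ?_
  unfold repJumps
  have : {q : Fin 3 × Fin 3 | (q.2 : ℕ) = (q.1 : ℕ) + 1 ∧
      (![0, 1 / (2 * η), 0] : Fin 3 → ℝ) q.1 ≠ (![0, 1 / (2 * η), 0] : Fin 3 → ℝ) q.2} ⊆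
      {((0 : Fin 3), (1 : Fin 3)), (1, 2)} := by
    rintro ⟨a, b⟩ ⟨h, _⟩
    fin_cases a <;> fin_cases b <;> simp at h ⊢
  refine (Set.ncard_le_ncard this (Set.toFinite _)).trans ?_
  exact (Set.ncard_insert_le _ _).trans (by simp)

lemma peak_conv {ε : ℝ} (hε' : ε < 1 / 8) {g : ℝ → ℝ}
    (hsupp : ∀ x, x ∉ Set.Icc (1 / 2 - ε) (1 / 2 + ε) → g x = 0) {η : ℝ} (hη : 0 < η)
    (hη' : η < 1 / 8) {x : ℝ} (hx : x ∈ Ioc (0 : ℝ) 1) :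
    cyclicConv g (peak η) x = (1 / (2 * η)) * ∫ s in Ioc (-η) η, g (x + s) := by
  rw [cyclicConv_eq, intervalIntegral.integral_of_le zero_le_one]
  have h1 : ∀ y, kerG g (x - y) * peak η y =
      (Ioc (1 / 2 - η) (1 / 2 + η)).indicator (fun y => (1 / (2 * η)) * kerG g (x - y)) y := by
    intro y
    unfold peak
    by_cases h : y ∈ Ioc (1 / 2 - η) (1 / 2 + η)
    · simp only [indicator_of_mem h]; ring
    · simp only [indicator_of_notMem h, mul_zero]
  simp_rw [h1]
  rw [setIntegral_indicator measurableSet_Ioc]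
  have h2 : Ioc (0 : ℝ) 1 ∩ Ioc (1 / 2 - η) (1 / 2 + η) = Ioc (1 / 2 - η) (1 / 2 + η) := by
    apply inter_eq_right.2
    intro y hy
    exact ⟨by linarith [hy.1], by linarith [hy.2]⟩
  rw [h2, integral_const_mul]
  congr 1
  rw [← intervalIntegral.integral_of_le (by linarith), ← intervalIntegral.integral_of_le (by linarith)]
  rw [intervalIntegral.integral_comp_sub_left (kerG g) x]
  have h3 := intervalIntegral.integral_comp_add_left (a := -η) (b := η) (kerG g) (x - 1 / 2)
  rw [show x - (1 / 2 + η) = x - 1 / 2 + -η by ring, show x - (1 / 2 - η) = x - 1 / 2 + η by ring,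
    ← h3]
  refine intervalIntegral.integral_congr ?_
  intro s hs
  rw [uIcc_of_le (by linarith)] at hs
  obtain ⟨hs1, hs2⟩ := hs
  obtain ⟨hx1, hx2⟩ := hx
  simp only [kerG]
  rw [show x - 1 / 2 + s + 1 / 2 = x + s by ring]
  by_cases ha : x + s < 0
  · have : Int.fract (x + s) = x + s + 1 := by
      rw [← Int.fract_add_one, Int.fract_eq_self.2 ⟨by linarith, by linarith⟩]
    rw [this, hsupp, hsupp]
    · intro h; linarith [h.1]
    · intro h; linarith [h.2]
  · by_cases hb : x + s < 1
    · rw [Int.fract_eq_self.2 ⟨by linarith, hb⟩]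
    · have : Int.fract (x + s) = x + s - 1 := by
        rw [← Int.fract_sub_one, Int.fract_eq_self.2 ⟨by linarith, by linarith⟩]
      rw [this, hsupp, hsupp]
      · intro h; linarith [h.2]
      · intro h; linarith [h.1]

lemma peak_small {p ε : ℝ} (hp : 1 ≤ p) (hε' : ε < 1 / 8) {g : ℝ → ℝ} (hmeas : Measurable g)
    (hLp : IntegrableOn (fun x => |g x| ^ p) (Set.Icc 0 1))
    (hsupp : ∀ x, x ∉ Set.Icc (1 / 2 - ε) (1 / 2 + ε) → g x = 0) {δ : ℝ} (hδ : 0 < δ) :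
    ∃ η > 0, η < 1 / 8 ∧ ∫ x in (0 : ℝ)..1, |cyclicConv g (peak η) x - g x| ^ p ≤ δ := by
  have h0 : ENNReal.ofReal p ≠ 0 := by simp; linarith
  have h1p : 1 ≤ ENNReal.ofReal p := by simpa using ENNReal.ofReal_le_ofReal hp
  have hg := g_memLp_full hp hε' hmeas hLp hsupp
  obtain ⟨η₀, hη₀, htr⟩ := translation_cont hp hg hδ
  obtain ⟨η, hη, hη2⟩ := exists_between (lt_min hη₀ (show (0 : ℝ) < 1 / 8 by norm_num))
  obtain ⟨hηa, hηb⟩ := lt_min_iff.1 hη2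
  refine ⟨η, hη, hηb, ?_⟩
  set μ := volume.restrict (Ioc (0 : ℝ) 1) with hμ
  set ν := ENNReal.ofReal (1 / (2 * η)) • volume.restrict (Ioc (-η) η) with hν
  have hνp : IsProbabilityMeasure ν := by
    constructor
    rw [hν, Measure.smul_apply, Measure.restrict_apply_univ, Real.volume_Ioc, smul_eq_mul,
      ← ENNReal.ofReal_mul (by positivity)]
    rw [show 1 / (2 * η) * (η - -η) = 1 by field_simp; ring, ENNReal.ofReal_one]
  have hνi : ∀ f : ℝ → ℝ, ∫ s, f s ∂ν = (1 / (2 * η)) * ∫ s in Ioc (-η) η, f s := by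
    intro f
    rw [hν, integral_smul_measure, ENNReal.toReal_ofReal (by positivity), smul_eq_mul]
  have hgs : ∀ x, MemLp (fun s => g (x + s) - g x) (ENNReal.ofReal p) ν := by
    intro x
    have h1 : MemLp (fun s => g (x + s)) (ENNReal.ofReal p) volume :=
      hg.comp_measurePreserving (measurePreserving_add_left volume x)
    have h2 : MemLp (fun s => g (x + s)) (ENNReal.ofReal p) ν :=
      (h1.restrict _).smul_measure ENNReal.ofReal_ne_top
    exact h2.sub (memLp_const _)
  have hgx : ∀ s, MemLp (fun x => g (s + x) - g x) (ENNReal.ofReal p) volume := fun s =>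
    (hg.comp_measurePreserving (measurePreserving_add_left volume s)).sub hg
  have hgxi : ∀ s, Integrable (fun x => |g (s + x) - g x| ^ p) volume := by
    intro s
    have := (hgx s).integrable_norm_rpow h0 ENNReal.ofReal_ne_top
    rwa [ENNReal.toReal_ofReal (by linarith)] at this
  have hjens : ∀ x ∈ Ioc (0 : ℝ) 1, |cyclicConv g (peak η) x - g x| ^ p ≤
      ∫ s, |g (x + s) - g x| ^ p ∂ν := by
    intro x hx
    have hi := (hgs x).integrable h1p
    have hip : Integrable (fun s => |g (x + s) - g x| ^ p) ν := by
      have := (hgs x).integrable_norm_rpow h0 ENNReal.ofReal_ne_top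
      rwa [ENNReal.toReal_ofReal (by linarith)] at this
    have hi2 : Integrable (fun s => g (x + s)) ν := by
      have := hi.add (integrable_const (g x))
      refine this.congr (Eventually.of_forall fun s => ?_)
      simp
    have e1 : cyclicConv g (peak η) x - g x = ∫ s, (g (x + s) - g x) ∂ν := by
      rw [integral_sub hi2 (integrable_const _), hνi, ← peak_conv hε' hsupp hη hηb hx]
      simp
    have e2 : |cyclicConv g (peak η) x - g x| ≤ ∫ s, |g (x + s) - g x| ∂ν := by
      rw [e1]; exact abs_integral_le_integral_abs
    refine (Real.rpow_le_rpow (abs_nonneg _) e2 (by linarith)).trans ?_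
    exact (convexOn_rpow hp).map_integral_le
      (Real.continuous_rpow_const (by linarith)).continuousOn isClosed_Ici
      (Eventually.of_forall fun s => mem_Ici.2 (abs_nonneg _)) hi.abs hip
  have hmsr : Measurable (Function.uncurry fun x s => |g (x + s) - g x| ^ p) := by
    have : Measurable fun q : ℝ × ℝ => g (q.1 + q.2) - g q.1 :=
      (hmeas.comp (measurable_fst.add measurable_snd)).sub (hmeas.comp measurable_fst)
    exact this.abs.pow_const p
  have hbound : ∀ᵐ s ∂ν, ∫ x, |g (x + s) - g x| ^ p ∂μ ≤ δ := by
    refine Measure.ae_smul_measure ?_ _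
    filter_upwards [ae_restrict_mem measurableSet_Ioc] with s hs
    refine le_trans ?_ (htr s ?_)
    · simp_rw [add_comm _ s]
      exact setIntegral_le_integral (hgxi s) (Eventually.of_forall fun x => by positivity)
    · rw [abs_lt]; exact ⟨by linarith [hs.1], by linarith [hs.2]⟩
  have hnonneg : ∀ s, 0 ≤ ∫ x, |g (x + s) - g x| ^ p ∂μ := fun s =>
    integral_nonneg fun x => by positivity
  have hIs : Integrable (fun s => ∫ x, |g (x + s) - g x| ^ p ∂μ) ν := by
    refine Integrable.of_bound (C := δ) ?_ ?_
    · have := hmsr.comp measurable_swap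
      exact (this.stronglyMeasurable.integral_prod_right' (ν := μ)).aestronglyMeasurable
    · filter_upwards [hbound] with s hs
      rw [Real.norm_of_nonneg (hnonneg s)]; exact hs
  have hint : Integrable (Function.uncurry fun x s => |g (x + s) - g x| ^ p) (μ.prod ν) := by
    rw [integrable_prod_iff' hmsr.aestronglyMeasurable]
    constructor
    · refine Eventually.of_forall fun s => ?_
      have := (hgxi s).restrict (s := Ioc (0 : ℝ) 1)
      simp_rw [add_comm s] at this
      exact this
    · refine hIs.congr (Eventually.of_forall fun s => ?_)
      refine integral_congr_ae (Eventually.of_forall fun x => ?_)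
      simp only [Function.uncurry_apply_pair]
      rw [Real.norm_of_nonneg (by positivity)]
  rw [intervalIntegral.integral_of_le zero_le_one]
  calc ∫ x, |cyclicConv g (peak η) x - g x| ^ p ∂μ
      ≤ ∫ x, ∫ s, |g (x + s) - g x| ^ p ∂ν ∂μ := by
        refine integral_mono_of_nonneg (Eventually.of_forall fun x => by positivity)
          hint.integral_prod_left ?_
        filter_upwards [ae_restrict_mem measurableSet_Ioc] with x hx
        exact hjens x hx
    _ = ∫ s, ∫ x, |g (x + s) - g x| ^ p ∂μ ∂ν := integral_integral_swap hint
    _ ≤ ∫ s, δ ∂ν := integral_mono_ae hIs (integrable_const _) hbound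
    _ = δ := by simp

end Helpers

/-- For `0 < γ < γ₀`, the infimum over step functions of the continuous-time
inverse Potts functional equals `2γ`, and every step function has strictly
larger Potts value; in particular the infimum is not attained, i.e. the
continuous-time inverse Potts functional has no minimizer. -/
theorem continuous_inverse_potts_no_minimizer (p ε : ℝ) (hp : 1 ≤ p)
    (hε : 0 < ε) (hε' : ε < 1 / 8)
    (g : ℝ → ℝ) (hmeas : Measurable g) (hg0 : ∀ x, 0 ≤ g x)
    (hLp : IntegrableOn (fun x => |g x| ^ p) (Set.Icc 0 1))
    (hmass : ∫ x in (0 : ℝ)..1, g x = 1)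
    (hsupp : ∀ x, x ∉ Set.Icc (1 / 2 - ε) (1 / 2 + ε) → g x = 0)
    (γ : ℝ) (hγ : 0 < γ)
    (hγ0 : γ < (1 / 2) *
      min ((volume {x ∈ Set.Icc (0 : ℝ) 1 | 2 ≤ g x}).toReal) (1 / 4)) :
    sInf {r : ℝ | ∃ u : ℝ → ℝ, IsStepFun u ∧ r = contPotts γ p g u} = 2 * γ ∧
    ∀ u : ℝ → ℝ, IsStepFun u → 2 * γ < contPotts γ p g u := by
  have hlow : ∀ u : ℝ → ℝ, IsStepFun u → 2 * γ < contPotts γ p g u := by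
    intro u hu
    obtain ⟨k₀, t₀, c₀, h₀⟩ := hu
    have hmem : numJumps u ∈ {j : ℕ | ∃ (k : ℕ) (t : Fin (k + 1) → ℝ) (c : Fin k → ℝ),
        IsStepRep u t c ∧ j = repJumps c} := Nat.sInf_mem ⟨_, k₀, t₀, c₀, h₀, rfl⟩
    obtain ⟨k, t, c, h, hJ⟩ := hmem
    have hum := step_aesm h
    have hub := step_bdd h
    have hint := diff_integrable hp hmeas hg0 hLp hmass hum hub
    have hnn : ∀ x, 0 ≤ |cyclicConv g u x - g x| ^ p := fun x => by positivity
    unfold contPotts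
    rw [intervalIntegral.integral_of_le zero_le_one]
    by_cases hJ1 : numJumps u ≤ 1
    · rw [hJ] at hJ1
      obtain ⟨T, a, b, ha, hb⟩ := few_jumps h hJ1
      have hbad := bad_set hε hε' hmeas hg0 hmass hsupp hum hub ha hb
      have hBm : MeasurableSet {x | 1 ≤ |cyclicConv g u x - g x|} :=
        measurableSet_le measurable_const
          (((conv_aesm hmeas hum).measurable.sub hmeas).abs)
      have hI : volume.real {x ∈ Set.Ioc (0 : ℝ) 1 | 1 ≤ |cyclicConv g u x - g x|} ≤
          ∫ x in Set.Ioc (0 : ℝ) 1, |cyclicConv g u x - g x| ^ p := by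
        have e1 : volume.real {x ∈ Set.Ioc (0 : ℝ) 1 | 1 ≤ |cyclicConv g u x - g x|} =
            ∫ x in Set.Ioc (0 : ℝ) 1,
              {x | 1 ≤ |cyclicConv g u x - g x|}.indicator (fun _ => (1 : ℝ)) x := by
          rw [setIntegral_indicator hBm]
          simp [Set.inter_def]
        rw [e1]
        refine integral_mono_of_nonneg (Eventually.of_forall fun x =>
          Set.indicator_nonneg (fun _ _ => zero_le_one) x) hint (Eventually.of_forall fun x => ?_)
        refine Set.indicator_le' (s := {x | 1 ≤ |cyclicConv g u x - g x|}) (f := fun _ => (1 : ℝ))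
          (g := fun x => |cyclicConv g u x - g x| ^ p) ?_ ?_ x
        · intro y hy
          exact Real.one_le_rpow hy (by linarith)
        · intro y _
          exact hnn y
      have : 0 ≤ γ * (numJumps u : ℝ) := by positivity
      linarith
    · have hJ2 : (2 : ℝ) ≤ numJumps u := by
        have : 2 ≤ numJumps u := by omega
        exact_mod_cast this
      have hpos : 0 < ∫ x in Set.Ioc (0 : ℝ) 1, |cyclicConv g u x - g x| ^ p := by
        refine lt_of_le_of_ne (integral_nonneg hnn) fun h0 => ?_
        rw [eq_comm, integral_eq_zero_iff_of_nonneg hnn hint] at h0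
        refine conv_ne hε' hmeas hg0 hmass hsupp hum hub ?_
        filter_upwards [h0] with x hx
        have := (Real.rpow_eq_zero (abs_nonneg _) (by linarith)).1 hx
        exact sub_eq_zero.1 (abs_eq_zero.1 this)
      nlinarith
  refine ⟨?_, hlow⟩
  have hpeak : ∀ δ : ℝ, 0 < δ → ∃ u, IsStepFun u ∧ contPotts γ p g u ≤ 2 * γ + δ := by
    intro δ hδ
    obtain ⟨η, hη, hη', hI⟩ := peak_small hp hε' hmeas hLp hsupp hδ
    refine ⟨peak η, ⟨3, _, _, peak_rep hη hη'⟩, ?_⟩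
    have hj : (numJumps (peak η) : ℝ) ≤ 2 := by exact_mod_cast peak_jumps hη hη'
    unfold contPotts
    nlinarith
  refine csInf_eq_of_forall_ge_of_forall_gt_exists_lt ?_ ?_ ?_
  · obtain ⟨u, hu, _⟩ := hpeak 1 one_pos
    exact ⟨_, u, hu, rfl⟩
  · rintro r ⟨u, hu, rfl⟩
    exact (hlow u hu).le
  · intro w hw
    obtain ⟨u, hu, hle⟩ := hpeak ((w - 2 * γ) / 2) (by linarith)
    exact ⟨_, ⟨u, hu, rfl⟩, by linarith⟩
end
end

section
/- Let 1 ≤ p < ∞, let 0 < ε < 1/8, and let g ∈ L^p[0,1] be a nonnegative function with ∫₀¹ g = 1 which vanishes outside [1/2 − ε, 1/2 + ε]. Let g̃(x) = g({x + 1/2}) and let A be the cyclic convolution operator (Au)(x) = ∫₀¹ g̃({x − y}) u(y) dy. For n ≥ 3 define the step functions u_n = (n/2)·1_{[1/2 − 1/n, 1/2 + 1/n]}. Then ‖A u_n − g‖_p → 0 as n → ∞; consequently, since each u_n has exactly two jumps, P_γ(u_n) → 2γ for every γ > 0, and hence the infimum of P_γ over step functions is at most 2γ. -/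
open Filter Topology MeasureTheory
open scoped BigOperators

noncomputable section

/-- The step function `u_n = (n/2)·1_{[1/2 − 1/n, 1/2 + 1/n]}`. -/
def uSeq (n : ℕ) : ℝ → ℝ := fun x =>
  if x ∈ Set.Icc (1 / 2 - 1 / (n : ℝ)) (1 / 2 + 1 / (n : ℝ)) then (n : ℝ) / 2 else 0

lemma aux_nat_switch (P : ℕ → Prop) (a b : ℕ) (hab : a ≤ b) (ha : P a) (hb : ¬ P b) :
    ∃ i, a ≤ i ∧ i < b ∧ P i ∧ ¬ P (i + 1) := by
  by_contra! h
  apply hb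
  have : ∀ m, a ≤ m → m ≤ b → P m := by
    intro m hm
    induction m, hm using Nat.le_induction with
    | base => exact fun _ => ha
    | succ k hk ih => exact fun hkb => h k hk (by omega) (ih (by omega))
  exact this b hab le_rfl

lemma aux_upper (n : ℕ) (hn : 3 ≤ n) :
    IsStepRep (uSeq n) ![0, 1 / 2 - 1 / (n : ℝ), 1 / 2 + 1 / (n : ℝ), 1] ![0, (n : ℝ) / 2, 0] := by
  have hn' : (3 : ℝ) ≤ n := by exact_mod_cast hn
  have h0 : 0 < 1 / (n : ℝ) := by positivity
  have h1 : 1 / (n : ℝ) ≤ 1 / 3 := by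
    apply one_div_le_one_div_of_le <;> linarith
  refine ⟨?_, rfl, rfl, ?_⟩
  · rw [Fin.strictMono_iff_lt_succ]
    intro i
    have h0' : 0 < (n : ℝ)⁻¹ := by simpa using h0
    have h1' : (n : ℝ)⁻¹ ≤ 1 / 3 := by simpa using h1
    fin_cases i <;> simp <;> linarith
  · intro j x hx
    fin_cases j
    · simp at hx
      simp only [uSeq, Set.mem_Icc]
      rw [if_neg]
      · simp
      · intro h; simp at h; linarith [h.1, hx.2]
    · simp at hx
      simp only [uSeq, Set.mem_Icc]
      rw [if_pos]
      · simp
      · simp; constructor <;> linarith [hx.1, hx.2]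
    · simp at hx
      simp only [uSeq, Set.mem_Icc]
      rw [if_neg]
      · simp
      · intro h; simp at h; linarith [h.2, hx.1]

lemma aux_upper_jumps (n : ℕ) (hn : 3 ≤ n) :
    repJumps (![0, (n : ℝ) / 2, 0] : Fin 3 → ℝ) = 2 := by
  have hn' : (n : ℝ) ≠ 0 := by
    have : n ≠ 0 := by omega
    exact_mod_cast this
  unfold repJumps
  have : {q : Fin 3 × Fin 3 | (q.2 : ℕ) = (q.1 : ℕ) + 1 ∧
      (![0, (n : ℝ) / 2, 0] : Fin 3 → ℝ) q.1 ≠ (![0, (n : ℝ) / 2, 0] : Fin 3 → ℝ) q.2}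
      = {((0 : Fin 3), (1 : Fin 3)), ((1 : Fin 3), (2 : Fin 3))} := by
    ext ⟨a, b⟩
    fin_cases a <;> fin_cases b <;> simp [hn', (div_ne_zero hn' two_ne_zero).symm]
  rw [this, Set.ncard_pair]
  simp

lemma aux_lower (n : ℕ) (hn : 3 ≤ n) (k : ℕ) (t : Fin (k + 1) → ℝ) (c : Fin k → ℝ)
    (h : IsStepRep (uSeq n) t c) : 2 ≤ repJumps c := by
  have hn' : (3 : ℝ) ≤ n := by exact_mod_cast hn
  have h0 : 0 < 1 / (n : ℝ) := by positivity
  have h1 : 1 / (n : ℝ) ≤ 1 / 3 := by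
    apply one_div_le_one_div_of_le <;> linarith
  obtain ⟨hmono, ht0, ht1, hc⟩ := h
  -- for any interval inside (0,1), there is a point and a piece containing it
  have key : ∀ a b : ℝ, 0 ≤ a → a < b → b ≤ 1 → ∃ x, a < x ∧ x < b ∧ ∃ j : Fin k,
      t j.castSucc < x ∧ x < t j.succ := by
    intro a b ha hab hb
    obtain ⟨x, hx, hxt⟩ := (Set.Ioo_infinite hab).exists_notMem_finite (Set.finite_range t)
    refine ⟨x, hx.1, hx.2, ?_⟩
    obtain ⟨i, -, hik, hi1, hi2⟩ := aux_nat_switch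
      (fun i => ∃ hi : i < k + 1, t ⟨i, hi⟩ < x) 0 k (Nat.zero_le _)
      ⟨by omega, by have : t 0 < x := by rw [ht0]; linarith [hx.1]
                    exact this⟩
      (by rintro ⟨hk, hlt⟩
          have : t (Fin.last k) < x := hlt
          rw [ht1] at this; linarith [hx.2])
    obtain ⟨_, hi1⟩ := hi1
    refine ⟨⟨i, hik⟩, hi1, ?_⟩
    have : ¬ t (Fin.succ ⟨i, hik⟩) < x := fun h => hi2 ⟨by omega, h⟩
    exact lt_of_le_of_ne (not_lt.1 this) (fun h => hxt ⟨_, h.symm⟩)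
  obtain ⟨x1, hx1, hx1', j1, hj1, hj1'⟩ := key 0 (1 / 2 - 1 / n) le_rfl (by linarith) (by linarith)
  obtain ⟨x2, hx2, hx2', j2, hj2, hj2'⟩ := key (1 / 2 - 1 / n) (1 / 2 + 1 / n) (by linarith)
    (by linarith) (by linarith)
  obtain ⟨x3, hx3, hx3', j3, hj3, hj3'⟩ := key (1 / 2 + 1 / n) 1 (by linarith)
    (by linarith) (by linarith)
  have c1 : c j1 = 0 := by
    rw [← hc j1 x1 ⟨hj1, hj1'⟩, uSeq, if_neg]
    rintro ⟨h, _⟩; linarith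
  have c2 : c j2 ≠ 0 := by
    rw [← hc j2 x2 ⟨hj2, hj2'⟩, uSeq, if_pos ⟨hx2.le, hx2'.le⟩]
    positivity
  have c3 : c j3 = 0 := by
    rw [← hc j3 x3 ⟨hj3, hj3'⟩, uSeq, if_neg]
    rintro ⟨_, h⟩; linarith
  have ord : ∀ (x y : ℝ) (i j : Fin k), x < y → t i.castSucc < x → y < t j.succ → i ≤ j := by
    intro x y i j hxy hi hj
    have : t i.castSucc < t j.succ := by linarith
    have := hmono.lt_iff_lt.1 this
    rw [Fin.lt_def] at this
    simp at this
    rw [Fin.le_def]; omega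
  have o12 := ord x1 x2 j1 j2 (by linarith) hj1 hj2'
  have o23 := ord x2 x3 j2 j3 (by linarith) hj2 hj3'
  obtain ⟨i, hi, hi', ⟨hik, hci⟩, hi2⟩ := aux_nat_switch
    (fun i => ∃ hi : i < k, c ⟨i, hi⟩ = 0) j1 j2 o12 ⟨j1.2, c1⟩ (by rintro ⟨_, h⟩; exact c2 h)
  obtain ⟨l, hl, hl', ⟨hlk, hcl⟩, hl2⟩ := aux_nat_switch
    (fun i => ∃ hi : i < k, c ⟨i, hi⟩ ≠ 0) j2 j3 o23 ⟨j2.2, c2⟩ (by rintro ⟨_, h⟩; exact h c3)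
  have hi1k : i + 1 < k := by have := j2.2; omega
  have hl1k : l + 1 < k := by have := j3.2; omega
  have hci' : c ⟨i + 1, hi1k⟩ ≠ 0 := fun h => hi2 ⟨hi1k, h⟩
  have hcl' : c ⟨l + 1, hl1k⟩ = 0 := by
    by_contra h; exact hl2 ⟨hl1k, h⟩
  unfold repJumps
  have hsub : {((⟨i, hik⟩ : Fin k), (⟨i + 1, hi1k⟩ : Fin k)),
      ((⟨l, hlk⟩ : Fin k), (⟨l + 1, hl1k⟩ : Fin k))} ⊆
      {q : Fin k × Fin k | (q.2 : ℕ) = (q.1 : ℕ) + 1 ∧ c q.1 ≠ c q.2} := by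
    rintro q (rfl | rfl)
    · exact ⟨rfl, by rw [hci]; exact hci'.symm⟩
    · exact ⟨rfl, by rw [hcl']; exact hcl⟩
  have hne : ((⟨i, hik⟩ : Fin k), (⟨i + 1, hi1k⟩ : Fin k)) ≠
      ((⟨l, hlk⟩ : Fin k), (⟨l + 1, hl1k⟩ : Fin k)) := by
    intro h
    have : i = l := by simpa using congrArg (fun q => (q.1 : ℕ)) h
    omega
  rw [← Set.ncard_pair hne]
  exact Set.ncard_le_ncard hsub (Set.toFinite _)

lemma aux_numJumps (n : ℕ) (hn : 3 ≤ n) : numJumps (uSeq n) = 2 := by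
  unfold numJumps
  apply le_antisymm
  · exact Nat.sInf_le ⟨3, _, _, aux_upper n hn, (aux_upper_jumps n hn).symm⟩
  · refine le_csInf ⟨2, ⟨3, _, _, aux_upper n hn, (aux_upper_jumps n hn).symm⟩⟩ ?_
    rintro j ⟨k, t, c, h, rfl⟩
    exact aux_lower n hn k t c h

/-- Uniform probability measure on `[-1/n, 1/n]`. -/
def auxMeas (n : ℕ) : Measure ℝ :=
  ENNReal.ofReal ((n : ℝ) / 2) • volume.restrict (Set.Icc (-(1 / (n : ℝ))) (1 / (n : ℝ)))

lemma auxMeas_prob (n : ℕ) (hn : 3 ≤ n) : IsProbabilityMeasure (auxMeas n) := by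
  have hn' : (3 : ℝ) ≤ n := by exact_mod_cast hn
  constructor
  simp only [auxMeas, Measure.smul_apply, Measure.restrict_apply MeasurableSet.univ,
    Set.univ_inter, Real.volume_Icc, smul_eq_mul]
  rw [← ENNReal.ofReal_mul (by positivity), ← ENNReal.ofReal_one]
  congr 1
  field_simp
  ring

lemma aux_conv (ε : ℝ) (hε' : ε < 1 / 8) (g : ℝ → ℝ)
    (hsupp : ∀ x, x ∉ Set.Icc (1 / 2 - ε) (1 / 2 + ε) → g x = 0)
    (n : ℕ) (hn : 3 ≤ n) (x : ℝ) (hx : x ∈ Set.Ioc (0 : ℝ) 1) :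
    cyclicConv g (uSeq n) x = ∫ s, g (s + x) ∂(auxMeas n) := by
  have hn' : (3 : ℝ) ≤ n := by exact_mod_cast hn
  have h0 : 0 < 1 / (n : ℝ) := by positivity
  have h1 : 1 / (n : ℝ) ≤ 1 / 3 := by
    apply one_div_le_one_div_of_le <;> linarith
  rw [auxMeas, integral_smul_measure, ← integral_indicator measurableSet_Icc,
    ENNReal.toReal_ofReal (by positivity), smul_eq_mul, ← integral_const_mul,
    ← integral_sub_left_eq_self _ volume (1 / 2 : ℝ)]
  rw [cyclicConv, intervalIntegral.integral_of_le zero_le_one,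
    ← integral_indicator measurableSet_Ioc]
  congr 1
  ext y
  by_cases hy : y ∈ Set.Icc (1 / 2 - 1 / (n : ℝ)) (1 / 2 + 1 / (n : ℝ))
  · have hy1 : y ∈ Set.Ioc (0 : ℝ) 1 := ⟨by linarith [hy.1], by linarith [hy.2]⟩
    have hy2 : 1 / 2 - y ∈ Set.Icc (-(1 / (n : ℝ))) (1 / (n : ℝ)) :=
      ⟨by linarith [hy.2], by linarith [hy.1]⟩
    rw [Set.indicator_of_mem hy1, Set.indicator_of_mem hy2, uSeq, if_pos hy, mul_comm]
    congr 1
    unfold shiftHalf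
    have e1 : Int.fract (Int.fract (x - y) + 1 / 2) = Int.fract (1 / 2 - y + x) := by
      have : Int.fract (x - y) + 1 / 2 = (1 / 2 - y + x) - (⌊x - y⌋ : ℤ) := by
        rw [Int.fract]; ring
      rw [this, Int.fract_sub_intCast]
    rw [e1]
    obtain ⟨w, hw⟩ : ∃ w, w = 1 / 2 - y + x := ⟨_, rfl⟩
    rw [← hw]
    have w1 : -(1 / 3) ≤ w := by linarith [hx.1, hy2.1]
    have w2 : w ≤ 4 / 3 := by linarith [hx.2, hy2.2]
    rcases lt_or_ge w 0 with hw0 | hw0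
    · have : Int.fract w = w + 1 := by
        rw [Int.fract_eq_iff]
        exact ⟨by linarith, by linarith, -1, by push_cast; ring⟩
      rw [this, hsupp w, hsupp (w + 1)]
      · intro h; linarith [h.2]
      · intro h; linarith [h.1]
    · rcases lt_or_ge w 1 with hw1 | hw1
      · rw [Int.fract_eq_self.2 ⟨hw0, hw1⟩]
      · have : Int.fract w = w - 1 := by
          rw [Int.fract_eq_iff]
          exact ⟨by linarith, by linarith, 1, by push_cast; ring⟩
        rw [this, hsupp w, hsupp (w - 1)]
        · intro h; linarith [h.1]
        · intro h; linarith [h.2]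
  · have hy2 : 1 / 2 - y ∉ Set.Icc (-(1 / (n : ℝ))) (1 / (n : ℝ)) := by
      intro h; exact hy ⟨by linarith [h.2], by linarith [h.1]⟩
    rw [Set.indicator_of_notMem hy2]
    have : shiftHalf g (Int.fract (x - y)) * uSeq n y = 0 := by
      simp only [uSeq, if_neg hy, mul_zero]
    rw [Set.indicator_apply, this]; simp

lemma aux_trans (p : ℝ) (hp : 1 ≤ p) (g : ℝ → ℝ) (hg : MemLp g (ENNReal.ofReal p) volume) :
    Tendsto (fun s : ℝ => ∫⁻ x, ‖g (s + x) - g x‖ₑ ^ p) (𝓝 0) (𝓝 0) := by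
  have : Fact (1 ≤ ENNReal.ofReal p) := ⟨by simpa using hp⟩
  have : Fact (ENNReal.ofReal p ≠ ⊤) := ⟨ENNReal.ofReal_ne_top⟩
  have hc : Continuous (fun s : ℝ => (DomAddAct.mk s) +ᵥ hg.toLp g) :=
    (DomAddAct.continuous_mk).vadd continuous_const
  have h1 : Tendsto (fun s : ℝ => edist ((DomAddAct.mk s) +ᵥ hg.toLp g) (hg.toLp g)) (𝓝 0)
      (𝓝 0) := by
    have := (hc.edist (continuous_const (y := hg.toLp g))).tendsto 0
    simpa using this
  have h2 := (ENNReal.continuous_rpow_const (y := p)).tendsto 0 |>.comp h1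
  rw [ENNReal.zero_rpow_of_pos (by linarith)] at h2
  refine h2.congr fun s => ?_
  simp only [Function.comp]
  rw [DomAddAct.mk_vadd_toLp, Lp.edist_toLp_toLp, eLpNorm_eq_lintegral_rpow_enorm_toReal
    (by simp; linarith) ENNReal.ofReal_ne_top, ENNReal.toReal_ofReal (by linarith),
    ← ENNReal.rpow_mul, one_div, inv_mul_cancel₀ (by linarith), ENNReal.rpow_one]
  rfl

lemma aux_bound (p ε : ℝ) (hp : 1 ≤ p) (hε' : ε < 1 / 8) (g : ℝ → ℝ) (hmeas : Measurable g)
    (hgint : Integrable g)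
    (hsupp : ∀ x, x ∉ Set.Icc (1 / 2 - ε) (1 / 2 + ε) → g x = 0)
    (n : ℕ) (hn : 3 ≤ n) :
    ‖∫ x in (0 : ℝ)..1, |cyclicConv g (uSeq n) x - g x| ^ p‖ₑ ≤
      ∫⁻ s, (∫⁻ x, ‖g (s + x) - g x‖ₑ ^ p) ∂(auxMeas n) := by
  have := auxMeas_prob n hn
  rw [intervalIntegral.integral_of_le zero_le_one]
  refine (enorm_integral_le_lintegral_enorm _).trans ?_
  have hpt : ∀ x ∈ Set.Ioc (0 : ℝ) 1, ‖|cyclicConv g (uSeq n) x - g x| ^ p‖ₑ ≤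
      ∫⁻ s, ‖g (s + x) - g x‖ₑ ^ p ∂(auxMeas n) := by
    intro x hx
    have hi : Integrable (fun s => g (s + x)) (auxMeas n) :=
      ((hgint.comp_add_right x).restrict).smul_measure ENNReal.ofReal_ne_top
    have e : cyclicConv g (uSeq n) x - g x = ∫ s, (g (s + x) - g x) ∂(auxMeas n) := by
      rw [aux_conv ε hε' g hsupp n hn x hx, integral_sub hi (integrable_const _)]
      simp
    rw [Real.enorm_rpow_of_nonneg (abs_nonneg _) (by linarith), Real.enorm_abs, e]
    have hm : AEStronglyMeasurable (fun s => g (s + x) - g x) (auxMeas n) := by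
      apply Measurable.aestronglyMeasurable; fun_prop
    have h1 : ‖∫ s, (g (s + x) - g x) ∂(auxMeas n)‖ₑ ≤
        eLpNorm (fun s => g (s + x) - g x) (ENNReal.ofReal p) (auxMeas n) := by
      refine (enorm_integral_le_lintegral_enorm _).trans ?_
      rw [← eLpNorm_one_eq_lintegral_enorm]
      exact eLpNorm_le_eLpNorm_of_exponent_le (by simpa using hp) hm
    refine (ENNReal.rpow_le_rpow h1 (by linarith : 0 ≤ p)).trans ?_
    rw [eLpNorm_eq_lintegral_rpow_enorm_toReal
      (by simp; linarith) ENNReal.ofReal_ne_top, ENNReal.toReal_ofReal (by linarith),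
      ← ENNReal.rpow_mul, one_div, inv_mul_cancel₀ (by linarith), ENNReal.rpow_one]
  refine (setLIntegral_mono' measurableSet_Ioc hpt).trans ?_
  refine (setLIntegral_le_lintegral _ _).trans ?_
  rw [lintegral_lintegral_swap]
  apply Measurable.aemeasurable
  fun_prop

lemma aux_tendsto (p ε : ℝ) (hp : 1 ≤ p) (hε : 0 < ε) (hε' : ε < 1 / 8)
    (g : ℝ → ℝ) (hmeas : Measurable g)
    (hLp : IntegrableOn (fun x => |g x| ^ p) (Set.Icc 0 1))
    (hmass : ∫ x in (0 : ℝ)..1, g x = 1)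
    (hsupp : ∀ x, x ∉ Set.Icc (1 / 2 - ε) (1 / 2 + ε) → g x = 0) :
    Tendsto (fun n : ℕ => ∫ x in (0 : ℝ)..1, |cyclicConv g (uSeq n) x - g x| ^ p)
      atTop (𝓝 0) := by
  have hz : ∀ x, x ∉ Set.Ioc (0 : ℝ) 1 → g x = 0 := by
    intro x hx
    apply hsupp
    intro h; exact hx ⟨by linarith [h.1], by linarith [h.2]⟩
  have hgint : Integrable g := by
    have h : IntervalIntegrable g volume 0 1 :=
      intervalIntegral.intervalIntegrable_of_integral_ne_zero (by rw [hmass]; exact one_ne_zero)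
    rw [intervalIntegrable_iff_integrableOn_Ioc_of_le zero_le_one] at h
    refine (integrableOn_iff_integrable_of_support_subset ?_).1 h
    intro x hx
    by_contra h'
    exact hx (hz x h')
  have hmem : MemLp g (ENNReal.ofReal p) volume := by
    rw [← integrable_norm_rpow_iff hmeas.aestronglyMeasurable (by simp; linarith)
      ENNReal.ofReal_ne_top, ENNReal.toReal_ofReal (by linarith)]
    refine (integrableOn_iff_integrable_of_support_subset ?_).1 hLp
    intro x hx
    by_contra h'
    apply hx
    have : g x = 0 := hz x (fun h => h' ⟨h.1.le, h.2⟩)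
    simp only [this, norm_zero]
    exact Real.zero_rpow (by linarith)
  have hT := aux_trans p hp g hmem
  rw [tendsto_zero_iff_enorm_tendsto_zero]
  rw [ENNReal.tendsto_nhds_zero] at hT ⊢
  intro δ hδ
  obtain ⟨r, hr, hball⟩ := Metric.eventually_nhds_iff.1 (hT δ hδ)
  have hlim : Tendsto (fun n : ℕ => 1 / (n : ℝ)) atTop (𝓝 0) := tendsto_one_div_atTop_nhds_zero_nat
  filter_upwards [eventually_ge_atTop 3, hlim.eventually (gt_mem_nhds hr)] with n hn hnr
  refine (aux_bound p ε hp hε' g hmeas hgint hsupp n hn).trans ?_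
  have := auxMeas_prob n hn
  have hae : ∀ᵐ s ∂(auxMeas n), (∫⁻ x, ‖g (s + x) - g x‖ₑ ^ p) ≤ δ := by
    apply Measure.ae_smul_measure
    filter_upwards [ae_restrict_mem measurableSet_Icc] with s hs
    apply hball
    rw [Real.dist_eq, sub_zero, abs_lt]
    exact ⟨by linarith [hs.1], by linarith [hs.2]⟩
  refine (lintegral_mono_ae hae).trans ?_
  simp

/-- For the step functions `u_n = (n/2)·1_{[1/2 − 1/n, 1/2 + 1/n]}` one has
`‖A u_n − g‖_p → 0`; each `u_n` (for `n ≥ 3`) has exactly two jumps, so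
`P_γ(u_n) → 2γ` for every `γ > 0`, and hence the infimum of `P_γ` over step
functions is at most `2γ`. -/
theorem continuous_inverse_potts_infimum_le (p ε : ℝ) (hp : 1 ≤ p)
    (hε : 0 < ε) (hε' : ε < 1 / 8)
    (g : ℝ → ℝ) (hmeas : Measurable g) (hg0 : ∀ x, 0 ≤ g x)
    (hLp : IntegrableOn (fun x => |g x| ^ p) (Set.Icc 0 1))
    (hmass : ∫ x in (0 : ℝ)..1, g x = 1)
    (hsupp : ∀ x, x ∉ Set.Icc (1 / 2 - ε) (1 / 2 + ε) → g x = 0) :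
    Tendsto (fun n : ℕ =>
        (∫ x in (0 : ℝ)..1, |cyclicConv g (uSeq n) x - g x| ^ p) ^ (1 / p))
      atTop (𝓝 0) ∧
    (∀ n : ℕ, 3 ≤ n → numJumps (uSeq n) = 2) ∧
    ∀ γ : ℝ, 0 < γ →
      Tendsto (fun n : ℕ => contPotts γ p g (uSeq n)) atTop (𝓝 (2 * γ)) ∧
      sInf {r : ℝ | ∃ u : ℝ → ℝ, IsStepFun u ∧ r = contPotts γ p g u} ≤ 2 * γ := by
  have hI := aux_tendsto p ε hp hε hε' g hmeas hLp hmass hsupp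
  have hP : ∀ γ : ℝ, Tendsto (fun n : ℕ => contPotts γ p g (uSeq n)) atTop (𝓝 (2 * γ)) := by
    intro γ
    have h := hI.const_add (γ * 2)
    rw [add_zero, mul_comm γ 2] at h
    refine h.congr' ?_
    filter_upwards [eventually_ge_atTop 3] with n hn
    rw [contPotts, aux_numJumps n hn]
    push_cast
    ring
  refine ⟨?_, aux_numJumps, fun γ hγ => ⟨hP γ, ?_⟩⟩
  · have h := hI.rpow_const (p := 1 / p) (Or.inr (by positivity))
    rwa [Real.zero_rpow (by positivity)] at h
  · refine ge_of_tendsto (hP γ) ?_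
    filter_upwards [eventually_ge_atTop 3] with n hn
    refine csInf_le ⟨0, ?_⟩ ⟨uSeq n, ⟨3, _, _, aux_upper n hn⟩, rfl⟩
    rintro r ⟨u, -, rfl⟩
    refine add_nonneg (by positivity) ?_
    exact intervalIntegral.integral_nonneg zero_le_one (fun x _ => by positivity)
end
end

section
/- Let 1 ≤ p < ∞, let 0 < ε < 1/8, and let g ∈ L^p[0,1] be a nonnegative function with ∫₀¹ g = 1 which vanishes outside [1/2 − ε, 1/2 + ε]. Let g̃(x) = g({x + 1/2}) and let A be the cyclic convolution operator (Au)(x) = ∫₀¹ g̃({x − y}) u(y) dy. Then for every step function u on [0,1] with at most one jump (i.e., u = a·1_{[0,t)} + c·1_{[t,1]} for some a, c ∈ ℝ and t ∈ (0,1), or u constant), one has ‖Au − g‖_p^p ≥ min(λ({x : g(x) ≥ 2}), 1/4), where λ denotes Lebesgue measure. -/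
open MeasureTheory
open scoped BigOperators

noncomputable section

namespace OneJump

/-- The periodised kernel. -/
lemma kernel_eq (g : ℝ → ℝ) (z : ℝ) :
    shiftHalf g (Int.fract z) = g (Int.fract (z + 1 / 2)) := by
  unfold shiftHalf
  congr 1
  rw [Int.fract_eq_fract]
  exact ⟨-⌊z⌋, by push_cast; rw [Int.fract]; ring⟩

lemma per_h (g : ℝ → ℝ) : Function.Periodic (fun z : ℝ => g (Int.fract z)) 1 := by
  intro z
  simp

lemma h_int_unit (g : ℝ → ℝ) (hg : IntervalIntegrable g volume 0 1) :
    IntervalIntegrable (fun z : ℝ => g (Int.fract z)) volume 0 1 := by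
  rw [intervalIntegrable_iff_integrableOn_Ioo_of_le zero_le_one] at hg ⊢
  refine hg.congr_fun ?_ measurableSet_Ioo
  intro x hx
  simp only
  rw [Int.fract_eq_self.2 ⟨hx.1.le, hx.2⟩]

lemma h_mass_unit (g : ℝ → ℝ) :
    ∫ z in (0 : ℝ)..1, g (Int.fract z) = ∫ z in (0 : ℝ)..1, g z := by
  rw [intervalIntegral.integral_of_le zero_le_one, intervalIntegral.integral_of_le zero_le_one,
    integral_Ioc_eq_integral_Ioo, integral_Ioc_eq_integral_Ioo]
  refine setIntegral_congr_fun measurableSet_Ioo ?_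
  intro x hx
  simp only
  rw [Int.fract_eq_self.2 ⟨hx.1.le, hx.2⟩]

lemma kernel_int (g : ℝ → ℝ) (hg : IntervalIntegrable g volume 0 1) (x : ℝ) :
    IntervalIntegrable (fun y => shiftHalf g (Int.fract (x - y))) volume 0 1 := by
  simp only [kernel_eq]
  have h1 : ∀ b d : ℝ, IntervalIntegrable (fun z : ℝ => g (Int.fract z)) volume b d :=
    fun b d => (per_h g).intervalIntegrable₀ one_ne_zero (h_int_unit g hg) b d
  have h2 := (h1 (x + 1 / 2 - 0) (x + 1 / 2 - 1)).comp_sub_left (x + 1 / 2)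
  simp only [sub_sub_cancel] at h2
  refine h2.congr ?_
  intro y _
  simp only
  congr 2
  ring

lemma kernel_mass (g : ℝ → ℝ) (x : ℝ) :
    ∫ y in (0 : ℝ)..1, shiftHalf g (Int.fract (x - y)) = ∫ z in (0 : ℝ)..1, g z := by
  simp only [kernel_eq]
  have h := intervalIntegral.integral_comp_sub_left
    (fun z : ℝ => g (Int.fract z)) (a := 0) (b := 1) (x + 1 / 2)
  have h2 := (per_h g).intervalIntegral_add_eq (x + 1 / 2 - 1) 0
  rw [sub_add_cancel, zero_add] at h2
  rw [sub_zero, h2, h_mass_unit] at h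
  rw [← h]
  congr 1
  ext y
  congr 2
  ring

lemma kernel_zero (g : ℝ → ℝ) (ε : ℝ)
    (hsupp : ∀ x, x ∉ Set.Icc (1 / 2 - ε) (1 / 2 + ε) → g x = 0) (z : ℝ)
    (h1 : z < 1 - ε) (h2 : -(1 - ε) < z) (h3 : z < -ε ∨ ε < z) (he : ε < 1 / 8) :
    shiftHalf g (Int.fract z) = 0 := by
  rw [kernel_eq]
  apply hsupp
  rintro ⟨k1, k2⟩
  rw [Int.fract] at k1 k2
  have k3 : (⌊z + 1 / 2⌋ : ℝ) < 1 := by linarith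
  have k4 : (-1 : ℝ) < ⌊z + 1 / 2⌋ := by linarith
  have k5 : ⌊z + 1 / 2⌋ < 1 := by exact_mod_cast k3
  have k6 : -1 < ⌊z + 1 / 2⌋ := by exact_mod_cast k4
  have k7 : ⌊z + 1 / 2⌋ = 0 := by omega
  rw [k7] at k1 k2
  push_cast at k1 k2
  rcases h3 with h | h <;> linarith

lemma conv_local (g : ℝ → ℝ) (ε : ℝ) (he : ε < 1 / 8)
    (hsupp : ∀ x, x ∉ Set.Icc (1 / 2 - ε) (1 / 2 + ε) → g x = 0)
    (hmass : ∫ x in (0 : ℝ)..1, g x = 1) (u : ℝ → ℝ) (x d : ℝ)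
    (hx1 : ε < x) (hx2 : x < 1 - ε)
    (hu : ∀ y, x - ε ≤ y → y ≤ x + ε → u y = d) : cyclicConv g u x = d := by
  unfold cyclicConv
  have : ∫ y in (0 : ℝ)..1, shiftHalf g (Int.fract (x - y)) * u y
      = ∫ y in (0 : ℝ)..1, shiftHalf g (Int.fract (x - y)) * d := by
    refine intervalIntegral.integral_congr ?_
    intro y hy
    rw [Set.uIcc_of_le zero_le_one] at hy
    simp only
    by_cases hc : x - ε ≤ y ∧ y ≤ x + ε
    · rw [hu y hc.1 hc.2]
    · rw [kernel_zero g ε hsupp (x - y) (by linarith [hy.1]) (by linarith [hy.2]) ?_ he]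
      · simp
      · by_contra hcon
        push Not at hcon
        exact hc ⟨by linarith, by linarith⟩
  rw [this, intervalIntegral.integral_mul_const, kernel_mass, hmass, one_mul]

lemma kernel_mul_int (g : ℝ → ℝ) (hg : IntervalIntegrable g volume 0 1) (a c t x : ℝ) :
    IntervalIntegrable
      (fun y => shiftHalf g (Int.fract (x - y)) * (if y < t then a else c)) volume 0 1 := by
  have hk := kernel_int g hg x
  rw [intervalIntegrable_iff] at hk ⊢
  refine Integrable.mul_bdd (c := max |a| |c|) hk ?_ ?_
  · exact (Measurable.ite measurableSet_Iio measurable_const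
      measurable_const).aestronglyMeasurable
  · refine Filter.Eventually.of_forall fun y => ?_
    split_ifs <;> simp

lemma conv_le (g : ℝ → ℝ) (hg0 : ∀ x, 0 ≤ g x) (hg : IntervalIntegrable g volume 0 1)
    (hmass : ∫ x in (0 : ℝ)..1, g x = 1) (a c t M x : ℝ) (ha : a ≤ M) (hc : c ≤ M) :
    cyclicConv g (fun y => if y < t then a else c) x ≤ M := by
  have h : ∫ y in (0 : ℝ)..1, shiftHalf g (Int.fract (x - y)) * M = M := by
    rw [intervalIntegral.integral_mul_const, kernel_mass, hmass, one_mul]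
  rw [← h]
  unfold cyclicConv
  refine intervalIntegral.integral_mono_on zero_le_one (kernel_mul_int g hg a c t x)
    ((kernel_int g hg x).mul_const M) ?_
  intro y _
  refine mul_le_mul_of_nonneg_left ?_ (hg0 _)
  dsimp only
  split_ifs <;> assumption

lemma le_conv (g : ℝ → ℝ) (hg0 : ∀ x, 0 ≤ g x) (hg : IntervalIntegrable g volume 0 1)
    (hmass : ∫ x in (0 : ℝ)..1, g x = 1) (a c t M x : ℝ) (ha : M ≤ a) (hc : M ≤ c) :
    M ≤ cyclicConv g (fun y => if y < t then a else c) x := by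
  have h : ∫ y in (0 : ℝ)..1, shiftHalf g (Int.fract (x - y)) * M = M := by
    rw [intervalIntegral.integral_mul_const, kernel_mass, hmass, one_mul]
  rw [← h]
  unfold cyclicConv
  refine intervalIntegral.integral_mono_on zero_le_one ((kernel_int g hg x).mul_const M)
    (kernel_mul_int g hg a c t x) ?_
  intro y _
  refine mul_le_mul_of_nonneg_left ?_ (hg0 _)
  dsimp only
  split_ifs <;> assumption

lemma conv_meas (g : ℝ → ℝ) (hmeas : Measurable g) (a c t : ℝ) :
    StronglyMeasurable (cyclicConv g (fun y => if y < t then a else c)) := by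
  unfold cyclicConv
  simp only [intervalIntegral.integral_of_le zero_le_one]
  have h : Measurable (fun q : ℝ × ℝ =>
      shiftHalf g (Int.fract (q.1 - q.2)) * (if q.2 < t then a else c)) := by
    refine Measurable.mul ?_ ?_
    · unfold shiftHalf
      exact hmeas.comp (measurable_fract.comp
        ((measurable_fract.comp (measurable_fst.sub measurable_snd)).add_const _))
    · exact Measurable.ite (measurable_snd measurableSet_Iio) measurable_const measurable_const
  exact h.stronglyMeasurable.integral_prod_right

/-- The set-theoretic core: the bad set has measure at least that of `E`, or contains enough. -/
lemma core (ε t : ℝ) (hε' : ε < 1 / 8)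
    (E S : Set ℝ) (hE : E ⊆ Set.Icc (1 / 2 - ε) (1 / 2 + ε)) (hEm : volume E ≤ ENNReal.ofReal (2 * ε))
    (f g : ℝ → ℝ) (a c : ℝ)
    (hfa : ∀ x, ε < x → x < t - ε → f x = a)
    (hfc : ∀ x, t + ε < x → x < 1 - ε → f x = c)
    (hle : ∀ M, a ≤ M → c ≤ M → ∀ x, f x ≤ M)
    (hge : ∀ M, M ≤ a → M ≤ c → ∀ x, M ≤ f x) (hε : 0 < ε)
    (hS1 : ∀ x ∈ E, f x ≤ 1 → x ∈ S)
    (hS2 : ∀ x, 0 < x → x < 1 → x ∉ Set.Icc (1 / 2 - ε) (1 / 2 + ε) → 1 ≤ f x → x ∈ S) :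
    volume E ≤ volume S := by
  have big : ∀ l : ℝ, Set.Ioo l (l + 2 * ε) ⊆ S → volume E ≤ volume S := by
    intro l hl
    refine hEm.trans (le_trans ?_ (measure_mono hl))
    rw [Real.volume_Ioo]
    exact ENNReal.ofReal_le_ofReal (by linarith)
  rcases le_or_gt a 1 with ha | ha <;> rcases le_or_gt c 1 with hc | hc
  · exact measure_mono fun x hx => hS1 x hx (hle 1 ha hc x)
  · -- `a ≤ 1 < c`
    rcases le_or_gt t (1 - 4 * ε) with h | h
    · refine big (1 - 3 * ε) ?_
      rintro x ⟨h1, h2⟩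
      refine hS2 x (by linarith) (by linarith) (fun h3 => by linarith [h3.2]) ?_
      rw [hfc x (by linarith) (by linarith)]
      exact hc.le
    · have hsub : E ⊆ (E ∩ Set.Iio (t - ε)) ∪ Set.Icc (t - ε) (1 / 2 + ε) := by
        intro x hx
        rcases lt_or_ge x (t - ε) with h1 | h1
        · exact Or.inl ⟨hx, h1⟩
        · exact Or.inr ⟨h1, (hE hx).2⟩
      have hsub2 : (E ∩ Set.Iio (t - ε)) ∪ Set.Ioo (t + ε) (1 - ε) ⊆ S := by
        rintro x (⟨h1, h2⟩ | ⟨h1, h2⟩)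
        · refine hS1 x h1 ?_
          rw [hfa x (by linarith [(hE h1).1]) h2]
          exact ha
        · refine hS2 x (by linarith) (by linarith) (fun h3 => by linarith [h3.2]) ?_
          rw [hfc x h1 h2]
          exact hc.le
      refine le_trans ?_ (measure_mono hsub2)
      rw [measure_union _ measurableSet_Ioo]
      · refine (measure_mono hsub).trans ((measure_union_le _ _).trans ?_)
        refine add_le_add le_rfl ?_
        rw [Real.volume_Icc, Real.volume_Ioo]
        exact ENNReal.ofReal_le_ofReal (by linarith)
      · rw [Set.disjoint_left]
        rintro x ⟨_, h1⟩ ⟨h2, _⟩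
        have h1' : x < t - ε := h1
        linarith
  · -- `c ≤ 1 < a`
    rcases le_or_gt (4 * ε) t with h | h
    · refine big ε ?_
      rintro x ⟨h1, h2⟩
      refine hS2 x (by linarith) (by linarith) (fun h3 => by linarith [h3.1]) ?_
      rw [hfa x (by linarith) (by linarith)]
      exact ha.le
    · have hsub : E ⊆ (E ∩ Set.Ioi (t + ε)) ∪ Set.Icc (1 / 2 - ε) (t + ε) := by
        intro x hx
        rcases lt_or_ge (t + ε) x with h1 | h1
        · exact Or.inl ⟨hx, h1⟩
        · exact Or.inr ⟨(hE hx).1, h1⟩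
      have hsub2 : (E ∩ Set.Ioi (t + ε)) ∪ Set.Ioo ε (t - ε) ⊆ S := by
        rintro x (⟨h1, h2⟩ | ⟨h1, h2⟩)
        · refine hS1 x h1 ?_
          rw [hfc x h2 (by linarith [(hE h1).2])]
          exact hc
        · refine hS2 x (by linarith) (by linarith) (fun h3 => by linarith [h3.1]) ?_
          rw [hfa x h1 h2]
          exact ha.le
      refine le_trans ?_ (measure_mono hsub2)
      rw [measure_union _ measurableSet_Ioo]
      · refine (measure_mono hsub).trans ((measure_union_le _ _).trans ?_)
        refine add_le_add le_rfl ?_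
        rw [Real.volume_Icc, Real.volume_Ioo]
        exact ENNReal.ofReal_le_ofReal (by linarith)
      · rw [Set.disjoint_left]
        rintro x ⟨_, h1⟩ ⟨_, h2⟩
        have h1' : t + ε < x := h1
        linarith
  · refine big 0 ?_
    rintro x ⟨h1, h2⟩
    exact hS2 x (by linarith) (by linarith) (fun h3 => by linarith [h3.1])
      (hge 1 ha.le hc.le x)

end OneJump

/-- For every step function `u` on `[0,1]` with at most one jump, i.e.
`u = a·1_{[0,t)} + c·1_{[t,1]}` (constants being the case `a = c`), one has
`‖Au − g‖_p^p ≥ min(λ({g ≥ 2}), 1/4)`. -/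
theorem data_term_lower_bound_one_jump (p ε : ℝ) (hp : 1 ≤ p)
    (hε : 0 < ε) (hε' : ε < 1 / 8)
    (g : ℝ → ℝ) (hmeas : Measurable g) (hg0 : ∀ x, 0 ≤ g x)
    (hLp : IntegrableOn (fun x => |g x| ^ p) (Set.Icc 0 1))
    (hmass : ∫ x in (0 : ℝ)..1, g x = 1)
    (hsupp : ∀ x, x ∉ Set.Icc (1 / 2 - ε) (1 / 2 + ε) → g x = 0)
    (a c t : ℝ) (ht : t ∈ Set.Ioo (0 : ℝ) 1) :
    min ((volume {x ∈ Set.Icc (0 : ℝ) 1 | 2 ≤ g x}).toReal) (1 / 4) ≤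
      ∫ x in (0 : ℝ)..1,
        |cyclicConv g (fun y => if y < t then a else c) x - g x| ^ p := by
  refine (min_le_left _ _).trans ?_
  have hg : IntervalIntegrable g volume 0 1 := by
    by_contra hcon
    rw [intervalIntegral.integral_undef hcon] at hmass
    exact zero_ne_one hmass
  set f := cyclicConv g (fun y => if y < t then a else c) with hf
  have hle : ∀ M, a ≤ M → c ≤ M → ∀ x, f x ≤ M := fun M h1 h2 x =>
    OneJump.conv_le g hg0 hg hmass a c t M x h1 h2
  have hge : ∀ M, M ≤ a → M ≤ c → ∀ x, M ≤ f x := fun M h1 h2 x =>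
    OneJump.le_conv g hg0 hg hmass a c t M x h1 h2
  have hfm : StronglyMeasurable f := OneJump.conv_meas g hmeas a c t
  have hp0 : 0 < p := by linarith
  have hpe0 : ENNReal.ofReal p ≠ 0 := by simpa using hp0
  have hpt : (ENNReal.ofReal p).toReal = p := ENNReal.toReal_ofReal hp0.le
  have hgLp : MemLp g (ENNReal.ofReal p) (volume.restrict (Set.Icc 0 1)) := by
    rw [← integrable_norm_rpow_iff hmeas.aestronglyMeasurable hpe0 ENNReal.ofReal_ne_top, hpt]
    exact hLp
  have hfLp : MemLp f (ENNReal.ofReal p) (volume.restrict (Set.Icc 0 1)) := by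
    refine MemLp.of_bound hfm.aestronglyMeasurable (max |a| |c|)
      (Filter.Eventually.of_forall fun x => ?_)
    rw [Real.norm_eq_abs, abs_le]
    refine ⟨hge _ ?_ ?_ x, hle _ ?_ ?_ x⟩
    · linarith [neg_abs_le a, le_max_left |a| |c|]
    · linarith [neg_abs_le c, le_max_right |a| |c|]
    · exact (le_abs_self a).trans (le_max_left _ _)
    · exact (le_abs_self c).trans (le_max_right _ _)
  have hint : Integrable (fun x => |f x - g x| ^ p) (volume.restrict (Set.Icc 0 1)) := by
    have h := (hfLp.sub hgLp).integrable_norm_rpow hpe0 ENNReal.ofReal_ne_top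
    rw [hpt] at h
    exact h
  rw [intervalIntegral.integral_of_le zero_le_one, ← integral_Icc_eq_integral_Ioc]
  have hmark := mul_meas_ge_le_integral_of_nonneg
    (Filter.Eventually.of_forall fun x => Real.rpow_nonneg (abs_nonneg (f x - g x)) p) hint 1
  rw [one_mul] at hmark
  refine le_trans ?_ hmark
  have hmf : Measurable (fun x => |f x - g x| ^ p) :=
    (hfm.measurable.sub hmeas).abs.pow_const p
  have hmS : MeasurableSet {x | 1 ≤ |f x - g x| ^ p} := measurableSet_le measurable_const hmf
  rw [Measure.real, Measure.restrict_apply hmS]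
  refine ENNReal.toReal_mono ?_ ?_
  · exact ((measure_mono Set.inter_subset_right).trans_lt measure_Icc_lt_top).ne
  have hE : {x ∈ Set.Icc (0 : ℝ) 1 | 2 ≤ g x} ⊆ Set.Icc (1 / 2 - ε) (1 / 2 + ε) := by
    rintro x ⟨_, hx⟩
    by_contra hcon
    rw [hsupp x hcon] at hx
    linarith
  refine OneJump.core ε t hε' _ _ hE ?_ f g a c ?_ ?_ hle hge hε ?_ ?_
  · refine (measure_mono hE).trans ?_
    rw [Real.volume_Icc]
    exact ENNReal.ofReal_le_ofReal (by linarith)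
  · intro x h1 h2
    refine OneJump.conv_local g ε hε' hsupp hmass _ x a h1 (by linarith [ht.2]) ?_
    intro y _ h3
    exact if_pos (by linarith)
  · intro x h1 h2
    refine OneJump.conv_local g ε hε' hsupp hmass _ x c (by linarith [ht.1]) h2 ?_
    intro y h3 _
    exact if_neg (by linarith)
  · rintro x ⟨hx1, hx2⟩ hfx
    refine ⟨Real.one_le_rpow ?_ hp0.le, hx1⟩
    rw [abs_sub_comm]
    exact le_trans (by linarith) (le_abs_self _)
  · intro x h1 h2 h3 h4
    refine ⟨Real.one_le_rpow ?_ hp0.le, h1.le, h2.le⟩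
    rw [hsupp x h3, sub_zero]
    exact h4.trans (le_abs_self _)
end
end
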